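/- arXiv:1609.04596 — 2 statements merged into one kernel-verified Lean document; each statement's English description precedes it below -/
import Mathlib

section
/- Let m ≥ 1, 1 < θ < 2, and let f : ℝ^m → ℝ satisfy (H0) and (H1) with parameters α, f₀ > 0. If (λ₁, φ) and (λ₂, ψ) are two solutions of the ergodic problem (EP) with φ and ψ bounded from below on ℝ^m, then λ₁ = λ₂ and there exists a constant C ∈ ℝ with φ = ψ + C. -/
open Filter

noncomputable def lap {m : ℕ} (φ : EuclideanSpace ℝ (Fin m) → ℝ)
    (y : EuclideanSpace ℝ (Fin m)) : ℝ :=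
  ∑ i : Fin m, iteratedFDeriv ℝ 2 φ y ![EuclideanSpace.single i 1, EuclideanSpace.single i 1]

def IsSubsolution {m : ℕ} (θ : ℝ) (f : EuclideanSpace ℝ (Fin m) → ℝ) (lam : ℝ)
    (φ : EuclideanSpace ℝ (Fin m) → ℝ) : Prop :=
  ContDiff ℝ 2 φ ∧
    ∀ y, -(1/2) * lap φ y + (1/θ) * ‖gradient φ y‖ ^ θ ≤ f y - lam

def IsSupersolution {m : ℕ} (θ : ℝ) (f : EuclideanSpace ℝ (Fin m) → ℝ) (lam : ℝ)
    (φ : EuclideanSpace ℝ (Fin m) → ℝ) : Prop :=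
  ContDiff ℝ 2 φ ∧
    ∀ y, -(1/2) * lap φ y + (1/θ) * ‖gradient φ y‖ ^ θ ≥ f y - lam

def IsSolution {m : ℕ} (θ : ℝ) (f : EuclideanSpace ℝ (Fin m) → ℝ) (lam : ℝ)
    (φ : EuclideanSpace ℝ (Fin m) → ℝ) : Prop :=
  ContDiff ℝ 2 φ ∧
    ∀ y, -(1/2) * lap φ y + (1/θ) * ‖gradient φ y‖ ^ θ = f y - lam

noncomputable def lambdaStar {m : ℕ} (θ : ℝ) (f : EuclideanSpace ℝ (Fin m) → ℝ) : ℝ :=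
  sSup {lam : ℝ | ∃ φ, IsSubsolution θ f lam φ}

def H0 {m : ℕ} (f : EuclideanSpace ℝ (Fin m) → ℝ) (α f₀ : ℝ) : Prop :=
  LocallyLipschitz f ∧ BddBelow (Set.range f) ∧
    ∀ y, DifferentiableAt ℝ f y →
      (1 ≤ α → ‖gradient f y‖ ≤ f₀ * (1 + ‖y‖ ^ (α - 1))) ∧
      (α < 1 → ‖gradient f y‖ ≤ f₀)

def H1 {m : ℕ} (f : EuclideanSpace ℝ (Fin m) → ℝ) (α f₀ : ℝ) : Prop :=
  ∀ y, f₀⁻¹ * (‖y‖ ^ α + 1) ≤ f y ∧ f y ≤ f₀ * (‖y‖ ^ α + 1)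

def MemPhi {m : ℕ} (γ : ℝ) (v : EuclideanSpace ℝ (Fin m) → ℝ) : Prop :=
  ContDiff ℝ 2 v ∧ ∃ c > 1, ∀ y, c⁻¹ * ‖y‖ ^ γ - c ≤ v y ∧ v y ≤ c * (1 + ‖y‖ ^ γ)

def Coercive {m : ℕ} (f : EuclideanSpace ℝ (Fin m) → ℝ) : Prop :=
  Tendsto f (cocompact (EuclideanSpace ℝ (Fin m))) atTop


open Filter MeasureTheory Topology

namespace Erg

abbrev E (m : ℕ) := EuclideanSpace ℝ (Fin m)

lemma lap_eq {m : ℕ} (u : E m → ℝ) (x : E m) :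
    lap u x = ∑ i : Fin m, fderiv ℝ (fderiv ℝ u) x (EuclideanSpace.single i 1)
      (EuclideanSpace.single i 1) := by
  unfold lap
  simp [iteratedFDeriv_two_apply]

lemma norm_grad {m : ℕ} (u : E m → ℝ) (x : E m) : ‖gradient u x‖ = ‖fderiv ℝ u x‖ := by
  unfold gradient
  simp

lemma diff2 {m : ℕ} {u : E m → ℝ} (hu : ContDiff ℝ 2 u) : Differentiable ℝ (fderiv ℝ u) :=
  (hu.fderiv_right (m := 1) (by norm_num)).differentiable (by norm_num)

lemma diff1 {m : ℕ} {u : E m → ℝ} (hu : ContDiff ℝ 2 u) : Differentiable ℝ u :=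
  hu.differentiable (by norm_num)

lemma cont_fderiv {m : ℕ} {u : E m → ℝ} (hu : ContDiff ℝ 2 u) : Continuous (fderiv ℝ u) :=
  (diff2 hu).continuous

lemma cont_fderiv2 {m : ℕ} {u : E m → ℝ} (hu : ContDiff ℝ 2 u) :
    Continuous (fderiv ℝ (fderiv ℝ u)) :=
  (hu.fderiv_right (m := 1) (by norm_num)).continuous_fderiv (by norm_num)

lemma contDiff_two {m : ℕ} {u : E m → ℝ} {u' : E m → (E m →L[ℝ] ℝ)}
    {u'' : E m → (E m →L[ℝ] (E m →L[ℝ] ℝ))}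
    (h1 : ∀ x, HasFDerivAt u (u' x) x) (h2 : ∀ x, HasFDerivAt u' (u'' x) x)
    (h3 : Continuous u'') : ContDiff ℝ 2 u := by
  have e1 : fderiv ℝ u = u' := funext fun x => (h1 x).fderiv
  have e2 : fderiv ℝ u' = u'' := funext fun x => (h2 x).fderiv
  have : ContDiff ℝ 1 u' := by
    rw [contDiff_one_iff_fderiv]
    exact ⟨fun x => (h2 x).differentiableAt, e2 ▸ h3⟩
  have h22 : (2 : WithTop ℕ∞) = 1 + 1 := by norm_num
  rw [h22, contDiff_succ_iff_fderiv]
  refine ⟨fun x => (h1 x).differentiableAt, by simp, e1 ▸ this⟩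

lemma fderiv2_sub {m : ℕ} {u v : E m → ℝ} (hu : ContDiff ℝ 2 u) (hv : ContDiff ℝ 2 v) (x : E m) :
    lap (fun y => u y - v y) x = lap u x - lap v x := by
  have e1 : fderiv ℝ (fun y => u y - v y) = fun y => fderiv ℝ u y - fderiv ℝ v y :=
    funext fun y => fderiv_fun_sub (diff1 hu y) (diff1 hv y)
  rw [lap_eq, lap_eq, lap_eq, e1, fderiv_fun_sub (diff2 hu x) (diff2 hv x)]
  simp

lemma lap_add {m : ℕ} {u v : E m → ℝ} (hu : ContDiff ℝ 2 u) (hv : ContDiff ℝ 2 v) (x : E m) :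
    lap (fun y => u y + v y) x = lap u x + lap v x := by
  have e1 : fderiv ℝ (fun y => u y + v y) = fun y => fderiv ℝ u y + fderiv ℝ v y :=
    funext fun y => fderiv_fun_add (diff1 hu y) (diff1 hv y)
  rw [lap_eq, lap_eq, lap_eq, e1, fderiv_fun_add (diff2 hu x) (diff2 hv x)]
  simp [Finset.sum_add_distrib]

lemma lap_const_mul {m : ℕ} {u : E m → ℝ} (hu : ContDiff ℝ 2 u) (c : ℝ) (x : E m) :
    lap (fun y => c * u y) x = c * lap u x := by
  have e1 : fderiv ℝ (fun y => c * u y) = fun y => c • fderiv ℝ u y :=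
    funext fun y => fderiv_const_mul (diff1 hu y) c
  rw [lap_eq, lap_eq, e1, fderiv_fun_const_smul (diff2 hu x)]
  simp [Finset.mul_sum]

lemma lap_add_const {m : ℕ} {u : E m → ℝ} (c : ℝ) (x : E m) :
    lap (fun y => u y + c) x = lap u x := by
  have e1 : fderiv ℝ (fun y => u y + c) = fun y => fderiv ℝ u y :=
    funext fun y => fderiv_add_const c
  rw [lap_eq, lap_eq, e1]

/-- composition data -/
lemma comp_data {m : ℕ} {u : E m → ℝ} (hu : ContDiff ℝ 2 u) {g g' g'' : ℝ → ℝ}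
    (h1 : ∀ t, HasDerivAt g (g' t) t) (h2 : ∀ t, HasDerivAt g' (g'' t) t) (h3 : Continuous g'') :
    ContDiff ℝ 2 (fun y => g (u y)) ∧
    (∀ x, fderiv ℝ (fun y => g (u y)) x = g' (u x) • fderiv ℝ u x) ∧
    (∀ x, lap (fun y => g (u y)) x = g' (u x) * lap u x + g'' (u x) * ‖fderiv ℝ u x‖ ^ 2) := by
  have a1 : ∀ x, HasFDerivAt (fun y => g (u y)) (g' (u x) • fderiv ℝ u x) x := fun x =>
    (h1 (u x)).comp_hasFDerivAt x (diff1 hu x).hasFDerivAt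
  have a2 : ∀ x, HasFDerivAt (fun y => g' (u y)) (g'' (u x) • fderiv ℝ u x) x := fun x =>
    (h2 (u x)).comp_hasFDerivAt x (diff1 hu x).hasFDerivAt
  have a3 : ∀ x, HasFDerivAt (fun y => g' (u y) • fderiv ℝ u y)
      (g' (u x) • fderiv ℝ (fderiv ℝ u) x + (g'' (u x) • fderiv ℝ u x).smulRight (fderiv ℝ u x)) x :=
    fun x => (a2 x).smul (diff2 hu x).hasFDerivAt
  have e1 : fderiv ℝ (fun y => g (u y)) = fun x => g' (u x) • fderiv ℝ u x :=
    funext fun x => (a1 x).fderiv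
  have cg' : Continuous g' := continuous_iff_continuousAt.2 fun t => (h2 t).continuousAt
  refine ⟨contDiff_two a1 a3 ?_, fun x => (a1 x).fderiv, fun x => ?_⟩
  · have c1 := cont_fderiv hu
    have c2 := cont_fderiv2 hu
    have c0 := (diff1 hu).continuous
    have : Continuous fun x => (g'' (u x) • fderiv ℝ u x) := (h3.comp c0).smul c1
    refine ((cg'.comp c0).smul c2).add ?_
    exact ((ContinuousLinearMap.smulRightL ℝ (E m) (E m →L[ℝ] ℝ)).continuous.comp this).clm_apply c1
  · rw [lap_eq, lap_eq, e1, (a3 x).fderiv]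
    have hn : ‖fderiv ℝ u x‖ ^ 2 = ∑ i, (fderiv ℝ u x (EuclideanSpace.single i 1)) ^ 2 := by
      rw [← norm_grad, EuclideanSpace.norm_sq_eq]
      refine Finset.sum_congr rfl fun i _ => ?_
      have : fderiv ℝ u x (EuclideanSpace.single i 1) =
          inner ℝ (gradient u x) (EuclideanSpace.single i 1) := by
        unfold gradient; simp
      rw [this, EuclideanSpace.inner_single_right]
      simp
    rw [hn, Finset.mul_sum, Finset.mul_sum, ← Finset.sum_add_distrib]
    refine Finset.sum_congr rfl fun i _ => ?_
    simp; ring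

lemma max_principle {m : ℕ} {u : E m → ℝ} (hu : ContDiff ℝ 2 u) {x : E m}
    (hx : IsLocalMax u x) : fderiv ℝ u x = 0 ∧ lap u x ≤ 0 := by
  have h0 := hx.fderiv_eq_zero
  refine ⟨h0, ?_⟩
  rw [lap_eq]
  refine Finset.sum_nonpos fun i _ => ?_
  set e : E m := EuclideanSpace.single i 1
  set g : ℝ → ℝ := fun t => u (x + t • e) with hg
  have hl : ∀ t : ℝ, HasDerivAt (fun t : ℝ => x + t • e) e t := fun t => by
    simpa using ((hasDerivAt_id t).smul_const e).const_add x
  have d1 : ∀ t, HasDerivAt g (fderiv ℝ u (x + t • e) e) t := fun t =>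
    (diff1 hu _).hasFDerivAt.comp_hasDerivAt t (hl t)
  have d2 : ∀ t, HasDerivAt (fun t : ℝ => fderiv ℝ u (x + t • e) e)
      (fderiv ℝ (fderiv ℝ u) (x + t • e) e e) t := fun t => by
    have := (diff2 hu (x + t • e)).hasFDerivAt.comp_hasDerivAt t (hl t)
    simpa using this.clm_apply (hasDerivAt_const t e)
  have e1 : deriv g = fun t => fderiv ℝ u (x + t • e) e := funext fun t => (d1 t).deriv
  have e2 : deriv (deriv g) 0 = fderiv ℝ (fderiv ℝ u) x e e := by
    rw [e1, (d2 0).deriv]; simp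
  by_contra hc
  push Not at hc
  have hmax : IsLocalMax g 0 := by
    have : Tendsto (fun t : ℝ => x + t • e) (𝓝 0) (𝓝 x) := by
      have := (hl 0).continuousAt.tendsto
      simpa using this
    have := this.eventually hx
    simpa [IsLocalMax, IsMaxFilter, hg] using this
  have hmin : IsLocalMin g 0 := by
    apply isLocalMin_of_deriv_deriv_pos (by rw [e2]; exact hc)
    · rw [e1]; simp [h0]
    · exact (d1 0).continuousAt
  have hconst : g =ᶠ[𝓝 0] fun _ => g 0 := by
    filter_upwards [hmax, hmin] with t h1 h2 using le_antisymm h1 h2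
  have h3 : deriv (deriv g) 0 = 0 := by
    have := hconst.deriv.deriv_eq
    rw [this]; simp
  rw [e2] at h3
  exact absurd h3 hc.ne'

/-- comparison of derivatives at a max of `u - v` -/
lemma max_sub {m : ℕ} {u v : E m → ℝ} (hu : ContDiff ℝ 2 u) (hv : ContDiff ℝ 2 v) {x : E m}
    (hx : ∀ y, u y - v y ≤ u x - v x) : fderiv ℝ v x = fderiv ℝ u x ∧ lap u x ≤ lap v x := by
  have hmax : IsLocalMax (fun y => u y - v y) x := Filter.Eventually.of_forall hx
  obtain ⟨h1, h2⟩ := max_principle (hu.sub hv) hmax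
  rw [fderiv2_sub hu hv] at h2
  have e1 : fderiv ℝ (fun y => u y - v y) x = fderiv ℝ u x - fderiv ℝ v x :=
    fderiv_fun_sub (diff1 hu x) (diff1 hv x)
  rw [e1] at h1
  exact ⟨(sub_eq_zero.1 h1).symm, by linarith⟩

end Erg

open Filter MeasureTheory Topology

namespace Erg

structure Ker {m : ℕ} (r : ℝ) (ρ : E m → ℝ) : Prop where
  cont : Continuous ρ
  nonneg : ∀ z, 0 ≤ ρ z
  supp : ∀ z, r < ‖z‖ → ρ z = 0
  int : ∫ z, ρ z = 1

noncomputable def moll {m : ℕ} {F : Type*} [NormedAddCommGroup F] [NormedSpace ℝ F]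
    (ρ : E m → ℝ) (g : E m → F) (y : E m) : F := ∫ z, ρ z • g (y + z)

variable {m : ℕ} {F : Type*} [NormedAddCommGroup F] [NormedSpace ℝ F]

lemma Ker.compact {r : ℝ} {ρ : E m → ℝ} (h : Ker r ρ) : HasCompactSupport ρ :=
  HasCompactSupport.intro (isCompact_closedBall (0 : E m) r) fun z hz => by
    apply h.supp; simpa using hz

lemma Ker.integrable {r : ℝ} {ρ : E m → ℝ} (h : Ker r ρ) {g : E m → F} (hg : Continuous g)
    (y : E m) : Integrable (fun z => ρ z • g (y + z)) := by
  have hc := h.cont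
  apply Continuous.integrable_of_hasCompactSupport
  · fun_prop
  · exact h.compact.smul_right

lemma Ker.integrable_mul {r : ℝ} {ρ : E m → ℝ} (h : Ker r ρ) {g : E m → ℝ} (hg : Continuous g)
    (y : E m) : Integrable (fun z => ρ z * g (y + z)) := h.integrable hg y

lemma Ker.moll_continuous {r : ℝ} {ρ : E m → ℝ} (h : Ker r ρ) {g : E m → F}
    (hg : Continuous g) : Continuous (moll ρ g) := by
  have hc := h.cont
  have := continuous_parametric_integral_of_continuous (μ := (volume : Measure (E m)))
    (f := fun y z => ρ z • g (y + z)) (by fun_prop) (isCompact_closedBall (0 : E m) r)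
  convert this using 2 with y
  unfold moll
  rw [setIntegral_eq_integral_of_forall_compl_eq_zero]
  intro z hz
  rw [h.supp z (by simpa using hz), zero_smul]

lemma Ker.moll_hasFDerivAt {r : ℝ} {ρ : E m → ℝ} (h : Ker r ρ) {g : E m → F}
    (hg : Differentiable ℝ g) (hg' : Continuous (fderiv ℝ g)) (y : E m) :
    HasFDerivAt (moll ρ g) (moll ρ (fderiv ℝ g) y) y := by
  have hc := h.cont
  have hgc := hg.continuous
  obtain ⟨B, hB⟩ := (isCompact_closedBall y (1 + r)).exists_bound_of_continuousOn hg'.continuousOn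
  refine hasFDerivAt_integral_of_dominated_of_fderiv_le (s := Metric.ball y 1)
    (F := fun y z => ρ z • g (y + z)) (F' := fun y z => ρ z • fderiv ℝ g (y + z))
    (bound := fun z => ρ z * B) (Metric.ball_mem_nhds y one_pos)
    (Eventually.of_forall fun x => (h.integrable hgc x).aestronglyMeasurable) (h.integrable hgc y)
    (h.integrable hg' y).aestronglyMeasurable ?_ ?_ ?_
  · refine Eventually.of_forall fun z x hx => ?_
    rw [norm_smul, Real.norm_of_nonneg (h.nonneg z)]
    by_cases hz : r < ‖z‖
    · simp [h.supp z hz]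
    · refine mul_le_mul_of_nonneg_left (hB _ ?_) (h.nonneg z)
      rw [Metric.mem_ball, dist_eq_norm] at hx
      rw [Metric.mem_closedBall, dist_eq_norm]
      calc ‖x + z - y‖ = ‖(x - y) + z‖ := by congr 1; abel
        _ ≤ _ := (norm_add_le _ _).trans (by linarith)
  · exact (h.cont.integrable_of_hasCompactSupport h.compact).mul_const B
  · refine Eventually.of_forall fun z x hx => ?_
    have h1 : HasFDerivAt (fun y => g (y + z)) (fderiv ℝ g (x + z)) x := by
      have := HasFDerivAt.comp x (hg (x + z)).hasFDerivAt ((hasFDerivAt_id x).add_const z)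
      simpa [Function.comp_def] using this
    exact h1.const_smul (ρ z)

lemma Ker.moll_contDiff {r : ℝ} {ρ : E m → ℝ} (h : Ker r ρ) {u : E m → ℝ}
    (hu : ContDiff ℝ 2 u) : ContDiff ℝ 2 (moll ρ u) ∧
    (∀ y, fderiv ℝ (moll ρ u) y = moll ρ (fderiv ℝ u) y) ∧
    (∀ y, lap (moll ρ u) y = moll ρ (lap u) y) := by
  have a1 := h.moll_hasFDerivAt (diff1 hu) (cont_fderiv hu)
  have a2 := h.moll_hasFDerivAt (diff2 hu) (cont_fderiv2 hu)
  have e1 : fderiv ℝ (moll ρ u) = moll ρ (fderiv ℝ u) := funext fun x => (a1 x).fderiv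
  refine ⟨contDiff_two a1 a2 (h.moll_continuous (cont_fderiv2 hu)), fun y => (a1 y).fderiv, ?_⟩
  intro y
  rw [lap_eq, e1, (a2 y).fderiv]
  have hi := h.integrable (F := E m →L[ℝ] E m →L[ℝ] ℝ) (g := fderiv ℝ (fderiv ℝ u)) (cont_fderiv2 hu) y
  have hterm : ∀ i : Fin m, moll ρ (fderiv ℝ (fderiv ℝ u)) y (EuclideanSpace.single i 1)
      (EuclideanSpace.single i 1) = ∫ z, ρ z • fderiv ℝ (fderiv ℝ u) (y + z)
        (EuclideanSpace.single i 1) (EuclideanSpace.single i 1) := by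
    intro i
    unfold moll
    rw [ContinuousLinearMap.integral_apply hi,
      ContinuousLinearMap.integral_apply (hi.apply_continuousLinearMap _)]
    rfl
  simp_rw [hterm]
  rw [← integral_finsetSum]
  · unfold moll
    congr 1
    ext z
    rw [lap_eq, Finset.smul_sum]
  · intro i _
    exact (hi.apply_continuousLinearMap _).apply_continuousLinearMap _

lemma cont_lap {u : E m → ℝ} (hu : ContDiff ℝ 2 u) : Continuous (lap u) := by
  have c2 := cont_fderiv2 hu
  have : lap u = fun x => ∑ i : Fin m, fderiv ℝ (fderiv ℝ u) x (EuclideanSpace.single i 1)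
      (EuclideanSpace.single i 1) := funext fun x => lap_eq u x
  rw [this]
  fun_prop

lemma Ker.moll_mono {r : ℝ} {ρ : E m → ℝ} (h : Ker r ρ) {g k : E m → ℝ}
    (hg : Continuous g) (hk : Continuous k) (y : E m)
    (hgk : ∀ z, ‖z‖ ≤ r → g (y + z) ≤ k (y + z)) : moll ρ g y ≤ moll ρ k y := by
  refine integral_mono (h.integrable hg y) (h.integrable hk y) fun z => ?_
  by_cases hz : r < ‖z‖
  · simp [h.supp z hz]
  · exact mul_le_mul_of_nonneg_left (hgk z (not_lt.1 hz)) (h.nonneg z)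

lemma Ker.moll_const {r : ℝ} {ρ : E m → ℝ} (h : Ker r ρ) (c : ℝ) (y : E m) :
    moll ρ (fun _ => c) y = c := by
  unfold moll
  simp only [smul_eq_mul]
  rw [integral_mul_const, h.int, one_mul]

lemma Ker.moll_le {r : ℝ} {ρ : E m → ℝ} (h : Ker r ρ) {g : E m → ℝ}
    (hg : Continuous g) (y : E m) {c : ℝ}
    (hgk : ∀ z, ‖z‖ ≤ r → g (y + z) ≤ c) : moll ρ g y ≤ c := by
  have := h.moll_mono hg (continuous_const (y := c)) y hgk
  rwa [h.moll_const] at this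

lemma Ker.le_moll {r : ℝ} {ρ : E m → ℝ} (h : Ker r ρ) {g : E m → ℝ}
    (hg : Continuous g) (y : E m) {c : ℝ}
    (hgk : ∀ z, ‖z‖ ≤ r → c ≤ g (y + z)) : c ≤ moll ρ g y := by
  have := h.moll_mono (continuous_const (y := c)) hg y hgk
  rwa [h.moll_const] at this

lemma Ker.norm_moll_le {r : ℝ} {ρ : E m → ℝ} (h : Ker r ρ) {g : E m → F}
    (y : E m) : ‖moll ρ g y‖ ≤ moll ρ (fun x => ‖g x‖) y := by
  refine (norm_integral_le_integral_norm _).trans (le_of_eq ?_)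
  unfold moll
  congr 1; ext z
  rw [norm_smul, Real.norm_of_nonneg (h.nonneg z), smul_eq_mul]

lemma tangent {θ : ℝ} (hθ : 1 < θ) {a t : ℝ} (ha : 0 ≤ a) (ht : 0 ≤ t) :
    t ^ θ + θ * t ^ (θ - 1) * (a - t) ≤ a ^ θ := by
  rcases ht.eq_or_lt with rfl | ht
  · rw [Real.zero_rpow (by linarith), Real.zero_rpow (by linarith)]
    simpa using Real.rpow_nonneg ha θ
  have h1 := one_add_mul_self_le_rpow_one_add (s := a / t - 1) (by
    have := div_nonneg ha ht.le; linarith) hθ.le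
  rw [show 1 + (a / t - 1) = a / t by ring, Real.div_rpow ha ht.le,
    le_div_iff₀ (Real.rpow_pos_of_pos ht θ)] at h1
  refine le_trans (le_of_eq ?_) h1
  rw [Real.rpow_sub_one ht.ne']
  field_simp

/-- Jensen -/
lemma Ker.jensen {r : ℝ} {ρ : E m → ℝ} (h : Ker r ρ) {g : E m → F} (hg : Continuous g)
    {θ : ℝ} (hθ : 1 < θ) (y : E m) :
    ‖moll ρ g y‖ ^ θ ≤ moll ρ (fun x => ‖g x‖ ^ θ) y := by
  set t := moll ρ (fun x => ‖g x‖) y with ht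
  have ht0 : 0 ≤ t := (norm_nonneg _).trans (h.norm_moll_le (g := g) y)
  have hcn : Continuous fun x => ‖g x‖ := hg.norm
  have hcp : Continuous fun x => ‖g x‖ ^ θ := hcn.rpow_const fun _ => Or.inr (by linarith)
  have h1 : moll ρ (fun x => t ^ θ + θ * t ^ (θ - 1) * (‖g x‖ - t)) y ≤
      moll ρ (fun x => ‖g x‖ ^ θ) y :=
    h.moll_mono (by fun_prop) hcp y fun z _ => tangent hθ (norm_nonneg _) ht0
  have h2 : moll ρ (fun x => t ^ θ + θ * t ^ (θ - 1) * (‖g x‖ - t)) y = t ^ θ := by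
    have e : (fun z => ρ z • (t ^ θ + θ * t ^ (θ - 1) * (‖g (y + z)‖ - t))) =
      fun z => (t ^ θ - θ * t ^ (θ - 1) * t) * ρ z +
        (θ * t ^ (θ - 1)) * (ρ z • ‖g (y + z)‖) := by
      ext z; simp only [smul_eq_mul]; ring
    have h3 : ∫ z, ρ z • ‖g (y + z)‖ = t := rfl
    unfold moll
    rw [e, integral_add, integral_const_mul, integral_const_mul, h.int, h3]
    · ring
    · exact (h.cont.integrable_of_hasCompactSupport h.compact).const_mul _
    · exact (h.integrable hcn y).const_mul _
  calc ‖moll ρ g y‖ ^ θ ≤ t ^ θ :=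
        Real.rpow_le_rpow (norm_nonneg _) (h.norm_moll_le y) (by linarith)
    _ ≤ _ := by rw [← h2]; exact h1

/-- integrate by parts -/
lemma Ker.moll_lap_le {r : ℝ} {ρ : E m → ℝ} (h : Ker r ρ) (hρ : ContDiff ℝ 1 ρ) {u : E m → ℝ}
    (hu : ContDiff ℝ 2 u) (y : E m) :
    moll ρ (lap u) y ≤ m * ∫ z, ‖fderiv ℝ ρ z‖ * ‖fderiv ℝ u (y + z)‖ := by
  have c1 := cont_fderiv hu
  have c2 := cont_fderiv2 hu
  have hc := h.cont
  have hρ' : Continuous (fderiv ℝ ρ) := hρ.continuous_fderiv (by norm_num)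
  have hcs' : HasCompactSupport (fderiv ℝ ρ) := h.compact.fderiv ℝ
  have hInt : Integrable fun z => ‖fderiv ℝ ρ z‖ * ‖fderiv ℝ u (y + z)‖ := by
    apply Continuous.integrable_of_hasCompactSupport
    · fun_prop
    · exact hcs'.norm.mul_right
  have key : ∀ i : Fin m, ∫ z, ρ z * fderiv ℝ (fderiv ℝ u) (y + z)
        (EuclideanSpace.single i 1) (EuclideanSpace.single i 1) ≤
        ∫ z, ‖fderiv ℝ ρ z‖ * ‖fderiv ℝ u (y + z)‖ := by
    intro i
    set e : E m := EuclideanSpace.single i 1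
    have he : ‖e‖ = 1 := by simp [e]
    have hd : ∀ z, HasFDerivAt (fun z => fderiv ℝ u (y + z) e)
        ((fderiv ℝ (fderiv ℝ u) (y + z)).flip e) z := by
      intro z
      have h1 : HasFDerivAt (fun z => fderiv ℝ u (y + z)) (fderiv ℝ (fderiv ℝ u) (y + z)) z := by
        have := HasFDerivAt.comp z (diff2 hu (y + z)).hasFDerivAt ((hasFDerivAt_id z).const_add y)
        simpa [Function.comp_def] using this
      have h2 := h1.clm_apply (hasFDerivAt_const e z)
      simpa using h2
    have hfe : ∀ z, fderiv ℝ (fun z => fderiv ℝ u (y + z) e) z e =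
        fderiv ℝ (fderiv ℝ u) (y + z) e e := fun z => by rw [(hd z).fderiv]; rfl
    have ibp := integral_mul_fderiv_eq_neg_fderiv_mul_of_integrable (𝕜 := ℝ)
      (μ := (volume : Measure (E m))) (f := ρ)
      (g := fun z => fderiv ℝ u (y + z) e) (v := e) ?_ ?_ ?_ ?_ ?_
    · simp_rw [hfe] at ibp
      rw [ibp, ← integral_neg]
      refine integral_mono ?_ hInt ?_
      · refine (Continuous.integrable_of_hasCompactSupport (by fun_prop) ?_).neg
        exact (hcs'.comp_left (g := fun (L : E m →L[ℝ] ℝ) => L e) rfl).mul_right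
      · intro z
        refine (neg_le_abs _).trans ?_
        rw [abs_mul]
        have b1 := (fderiv ℝ ρ z).le_opNorm e
        have b2 := (fderiv ℝ u (y + z)).le_opNorm e
        rw [he, mul_one] at b1 b2
        exact mul_le_mul b1 b2 (abs_nonneg _) (norm_nonneg _)
    · refine (Continuous.integrable_of_hasCompactSupport (by fun_prop) ?_)
      exact (hcs'.comp_left (g := fun (L : E m →L[ℝ] ℝ) => L e) rfl).mul_right
    · simp_rw [hfe]
      refine (Continuous.integrable_of_hasCompactSupport (by fun_prop) ?_)
      exact h.compact.mul_right
    · refine (Continuous.integrable_of_hasCompactSupport (by fun_prop) ?_)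
      exact h.compact.mul_right
    · exact fun x _ => hρ.differentiable (by norm_num) x
    · exact fun x _ => (hd x).differentiableAt
  have hs : moll ρ (lap u) y = ∑ i : Fin m, ∫ z, ρ z * fderiv ℝ (fderiv ℝ u) (y + z)
        (EuclideanSpace.single i 1) (EuclideanSpace.single i 1) := by
    rw [← integral_finsetSum]
    · unfold moll
      congr 1
      ext z
      rw [lap_eq, smul_eq_mul, Finset.mul_sum]
    · intro i _
      exact Continuous.integrable_of_hasCompactSupport (by fun_prop) h.compact.mul_right
  rw [hs]
  refine (Finset.sum_le_sum fun i _ => key i).trans ?_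
  simp

end Erg

open Filter MeasureTheory Topology

namespace Erg

noncomputable def pp (n : ℕ) (t : ℝ) : ℝ := (max t 0) ^ n

lemma pp_cont (n : ℕ) : Continuous (pp n) := by unfold pp; fun_prop

lemma pp_nonneg (n : ℕ) (t : ℝ) : 0 ≤ pp n t := pow_nonneg (le_max_right _ _) _

lemma pp_of_nonneg (n : ℕ) {t : ℝ} (ht : 0 ≤ t) : pp n t = t ^ n := by simp [pp, ht]

lemma pp_of_nonpos (n : ℕ) {t : ℝ} (ht : t ≤ 0) : pp (n + 1) t = 0 := by simp [pp, ht]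

lemma pp_deriv (n : ℕ) (t : ℝ) : HasDerivAt (pp (n + 2)) ((n + 2) * pp (n + 1) t) t := by
  rcases lt_trichotomy t 0 with ht | rfl | ht
  · rw [pp_of_nonpos _ ht.le, mul_zero]
    refine (hasDerivAt_const t (0 : ℝ)).congr_of_eventuallyEq ?_
    filter_upwards [gt_mem_nhds ht] with s hs
    exact pp_of_nonpos _ hs.le
  · rw [pp_of_nonpos _ le_rfl, mul_zero]
    have h1 : HasDerivAt (fun s : ℝ => s ^ 2) 0 0 := by simpa using hasDerivAt_pow 2 (0 : ℝ)
    rw [hasDerivAt_iff_isLittleO] at h1 ⊢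
    refine Asymptotics.IsBigO.trans_isLittleO ?_ h1
    refine Asymptotics.IsBigO.of_bound 1 ?_
    filter_upwards [Metric.ball_mem_nhds (0 : ℝ) one_pos] with s hs
    rw [pp_of_nonpos _ le_rfl]
    simp only [sub_zero, smul_zero, Real.norm_eq_abs, one_mul]
    rw [Metric.mem_ball, dist_zero_right, Real.norm_eq_abs, abs_lt] at hs
    rw [abs_of_nonneg (pp_nonneg _ _)]
    simp only [ne_eq, OfNat.ofNat_ne_zero, not_false_eq_true, zero_pow, sub_zero, abs_pow, sq_abs]
    rcases le_total s 0 with h | h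
    · rw [pp_of_nonpos _ h]; positivity
    · rw [pp_of_nonneg _ h]
      exact pow_le_pow_of_le_one h hs.2.le (by omega)
  · rw [pp_of_nonneg _ ht.le]
    have := hasDerivAt_pow (n + 2) t
    refine HasDerivAt.congr_of_eventuallyEq (f := fun s => s ^ (n + 2)) ?_ ?_
    · refine this.congr_deriv ?_
      push_cast; rfl
    · filter_upwards [lt_mem_nhds ht] with s hs
      exact pp_of_nonneg _ hs.le

variable {m : ℕ}

noncomputable def quad (a : ℝ) (z x : E m) : ℝ := a - ‖x - z‖ ^ 2

lemma quad_fderiv (a : ℝ) (z x : E m) :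
    HasFDerivAt (quad a z) ((-2 : ℝ) • innerSL ℝ (x - z)) x := by
  have h1 : HasFDerivAt (fun x : E m => ‖x - z‖ ^ 2)
      (2 • (innerSL ℝ (x - z)).comp (ContinuousLinearMap.id ℝ (E m))) x :=
    ((hasFDerivAt_id x).sub_const z).norm_sq
  have := h1.const_sub a
  refine this.congr_fderiv ?_
  ext v
  simp [two_smul]

lemma quad_data (a : ℝ) (z : E m) : ContDiff ℝ 2 (quad a z) ∧
    (∀ x, ‖fderiv ℝ (quad a z) x‖ = 2 * ‖x - z‖) ∧ (∀ x, lap (quad a z) x = -2 * m) := by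
  have h2 : ∀ x, HasFDerivAt (fun x : E m => (-2 : ℝ) • innerSL ℝ (x - z))
      ((-2 : ℝ) • (innerSL ℝ : E m →L[ℝ] E m →L[ℝ] ℝ)) x := by
    intro x
    have := ((innerSL ℝ : E m →L[ℝ] E m →L[ℝ] ℝ).hasFDerivAt (x := x - z)).comp x
      ((hasFDerivAt_id x).sub_const z)
    exact this.const_smul (-2 : ℝ)
  refine ⟨contDiff_two (quad_fderiv a z) h2 continuous_const, fun x => ?_, fun x => ?_⟩
  · rw [(quad_fderiv a z x).fderiv, norm_smul, innerSL_apply_norm]; norm_num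
  · have e1 : fderiv ℝ (quad a z) = fun x => (-2 : ℝ) • innerSL ℝ (x - z) :=
      funext fun x => (quad_fderiv a z x).fderiv
    rw [lap_eq, e1, (h2 x).fderiv]
    have : ∀ i : Fin m, innerSL ℝ (EuclideanSpace.single i (1 : ℝ)) (EuclideanSpace.single i (1 : ℝ)) = (1 : ℝ) := by
      intro i; rw [innerSL_apply_apply]; simp
    simp only [ContinuousLinearMap.smul_apply, this]
    simp; ring

noncomputable def bump (k : ℕ) (R : ℝ) (z x : E m) : ℝ := pp (k + 4) (quad (R ^ 2) z x)

lemma bump_data (k : ℕ) (R : ℝ) (z : E m) : ContDiff ℝ 2 (bump k R z) ∧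
    (∀ x, ‖fderiv ℝ (bump k R z) x‖ = (k + 4) * pp (k + 3) (quad (R ^ 2) z x) * (2 * ‖x - z‖)) ∧
    (∀ x, lap (bump k R z) x = (k + 4) * pp (k + 3) (quad (R ^ 2) z x) * (-2 * m) +
      (k + 4) * (k + 3) * pp (k + 2) (quad (R ^ 2) z x) * (4 * ‖x - z‖ ^ 2)) := by
  obtain ⟨q1, q2, q3⟩ := quad_data (R ^ 2) z
  have d1 : ∀ t, HasDerivAt (pp (k + 4)) ((k + 4) * pp (k + 3) t) t := fun t => by
    have := pp_deriv (k + 2) t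
    push_cast at this
    refine this.congr_deriv ?_
    norm_num [add_assoc]
  have d2 : ∀ t, HasDerivAt (fun t => (k + 4 : ℝ) * pp (k + 3) t)
      ((k + 4) * (k + 3) * pp (k + 2) t) t := fun t => by
    have := (pp_deriv (k + 1) t).const_mul (k + 4 : ℝ)
    refine this.congr_deriv ?_
    push_cast; ring
  obtain ⟨b1, b2, b3⟩ := comp_data q1 d1 d2 ((pp_cont (k + 2)).const_mul _)
  refine ⟨b1, fun x => ?_, fun x => ?_⟩
  · have : fderiv ℝ (bump k R z) x = _ := b2 x
    rw [this, norm_smul, q2, Real.norm_of_nonneg]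
    have := pp_nonneg (k + 3) (quad (R ^ 2) z x)
    positivity
  · have : lap (bump k R z) x = _ := b3 x
    rw [this, q2, q3]; ring

lemma bump_nonneg (k : ℕ) (R : ℝ) (z x : E m) : 0 ≤ bump k R z x := pp_nonneg _ _

lemma bump_zero (k : ℕ) {R : ℝ} (hR : 0 ≤ R) {z x : E m} (h : R ≤ ‖x - z‖) (j : ℕ) :
    pp (j + 1) (quad (R ^ 2) z x) = 0 := by
  apply pp_of_nonpos
  unfold quad
  have := pow_le_pow_left₀ hR h 2
  linarith

lemma exists_ker {θ : ℝ} (hθ : 1 < θ) {r : ℝ} (hr : 0 < r) (hr1 : r ≤ 1) :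
    ∃ ρ : E m → ℝ, Ker r ρ ∧ ContDiff ℝ 1 ρ ∧
      ∃ K, 0 ≤ K ∧ ∀ z, ‖fderiv ℝ ρ z‖ ≤ K * ρ z ^ (1 / θ) := by
  obtain ⟨k, hk⟩ := exists_nat_ge (1 / (θ - 1))
  have hk' : (k + 4 : ℝ) / θ ≤ k + 3 := by
    rw [div_le_iff₀ (by linarith)] at hk ⊢
    nlinarith
  obtain ⟨b1, b2, b3⟩ := bump_data k r (0 : E m)
  set β : E m → ℝ := bump k r 0 with hβ
  have hz : ∀ z, r < ‖z‖ → β z = 0 := fun z hz => bump_zero k hr.le (by simpa using hz.le) _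
  have hcs : HasCompactSupport β :=
    HasCompactSupport.intro (isCompact_closedBall (0 : E m) r) fun z h => by
      apply hz; simpa using h
  have hpos : 0 < ∫ z, β z := by
    refine b1.continuous.integral_pos_of_hasCompactSupport_nonneg_nonzero (x := 0) hcs
      (fun z => bump_nonneg _ _ _ _) ?_
    have : (0 : ℝ) ≤ r ^ 2 := by positivity
    simp [hβ, bump, quad, pp_of_nonneg _ this, hr.ne']
  set c := (∫ z, β z)⁻¹ with hc
  have hc0 : 0 < c := inv_pos.2 hpos
  refine ⟨fun z => c * β z, ⟨b1.continuous.const_mul c,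
    fun z => mul_nonneg hc0.le (bump_nonneg _ _ _ _), fun z h => by simp [hz z h], ?_⟩,
    (contDiff_const.mul b1).of_le (by norm_num), 2 * (k + 4) * c / c ^ (1 / θ), by positivity, ?_⟩
  · rw [integral_const_mul, hc, inv_mul_cancel₀ hpos.ne']
  · intro z
    have e : fderiv ℝ (fun z => c * β z) z = c • fderiv ℝ β z := fderiv_const_mul (diff1 b1 z) c
    rw [e, norm_smul, b2, Real.norm_of_nonneg hc0.le, sub_zero,
      Real.mul_rpow hc0.le (bump_nonneg _ _ _ _)]
    have hct : 0 < c ^ (1 / θ) := Real.rpow_pos_of_pos hc0 _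
    rw [show 2 * (k + 4) * c / c ^ (1 / θ) * (c ^ (1 / θ) * β z ^ (1 / θ)) =
      c * ((k + 4) * β z ^ (1 / θ) * 2) by field_simp]
    refine mul_le_mul_of_nonneg_left ?_ hc0.le
    rcases le_total r ‖z‖ with h | h
    · rw [bump_zero k hr.le (by simpa using h)]
      have := Real.rpow_nonneg (bump_nonneg k r 0 z) (1 / θ)
      rw [mul_zero, zero_mul]
      exact mul_nonneg (mul_nonneg (by positivity) this) (by norm_num)
    · have hq0 : 0 ≤ quad (r ^ 2) 0 z := by
        unfold quad; rw [sub_zero]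
        nlinarith [norm_nonneg z]
      have hq1 : quad (r ^ 2) 0 z ≤ 1 := by
        unfold quad; rw [sub_zero]
        nlinarith [norm_nonneg z]
      have hb : pp (k + 3) (quad (r ^ 2) 0 z) ≤ β z ^ (1 / θ) := by
        rw [hβ, bump, pp_of_nonneg _ hq0, pp_of_nonneg _ hq0, ← Real.rpow_natCast _ (k + 3),
          ← Real.rpow_natCast _ (k + 4),
          ← Real.rpow_mul hq0]
        rcases hq0.eq_or_lt with h0 | h0
        · rw [← h0, Real.zero_rpow, Real.zero_rpow]
          · have : (0 : ℝ) < θ := by linarith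
            positivity
          · positivity
        · apply Real.rpow_le_rpow_of_exponent_ge h0 hq1
          push_cast
          rw [mul_one_div]; exact hk'
      have hb0 := pp_nonneg (k + 3) (quad (r ^ 2) 0 z)
      have : 2 * ‖z‖ ≤ 2 := by linarith
      have hb1 := hb0.trans hb
      have : 0 ≤ (k + 4 : ℝ) * β z ^ (1 / θ) := mul_nonneg (by positivity) hb1
      gcongr

end Erg

open Filter MeasureTheory Topology

namespace Erg
variable {m : ℕ}

lemma lip_ball {g : E m → ℝ} {K : NNReal} (hg : LipschitzWith K g) (y0 : E m) {M : ℝ}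
    (hM0 : 0 ≤ M) (hM : ∀ x ∈ Metric.ball y0 3, DifferentiableAt ℝ g x → ‖fderiv ℝ g x‖ ≤ M)
    {a b : E m} (ha : ‖a - y0‖ ≤ 1) (hb : ‖b - y0‖ ≤ 1) : |g a - g b| ≤ M * ‖a - b‖ := by
  have key : ∀ r : ℝ, 0 < r → r ≤ 1 → |g a - g b| ≤ M * ‖a - b‖ + 2 * (K * r) := by
    intro r hr hr1
    obtain ⟨ρ, hρ, -, -⟩ := exists_ker (m := m) (θ := 2) (by norm_num) hr hr1
    have hgc := hg.continuous
    have hd : ∀ x, HasFDerivAt (moll ρ g) (∫ z, ρ z • fderiv ℝ g (x + z)) x := by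
      intro x
      refine (hasFDerivAt_integral_of_dominated_loc_of_lip (μ := (volume : Measure (E m)))
        (F := fun x z => ρ z • g (x + z)) (s := Set.univ) (bound := fun z => ρ z * K)
        univ_mem ?_ ?_ ?_ ?_ ?_ ?_).2
      · exact Eventually.of_forall fun x => (hρ.integrable hgc x).aestronglyMeasurable
      · exact hρ.integrable hgc x
      · have h1 : Measurable fun z => fderiv ℝ g (x + z) :=
          (measurable_fderiv ℝ g).comp (measurable_const_add x)
        exact hρ.cont.aestronglyMeasurable.smul h1.aestronglyMeasurable
      · refine Eventually.of_forall fun z => ?_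
        refine LipschitzWith.lipschitzOnWith (LipschitzWith.of_dist_le_mul fun u v => ?_)
        have h1 := hg.dist_le_mul (u + z) (v + z)
        rw [dist_add_right] at h1
        simp only [smul_eq_mul, Real.dist_eq, ← mul_sub, abs_mul] at h1 ⊢
        rw [Real.coe_nnabs, abs_mul, abs_of_nonneg K.coe_nonneg, mul_assoc]
        exact mul_le_mul_of_nonneg_left h1 (abs_nonneg _)
      · have := hρ.integrable (F := ℝ) (g := fun _ => (K : ℝ)) continuous_const 0
        simpa using this
      · have h1 := hg.ae_differentiableAt (μ := (volume : Measure (E m)))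
        have h2 := (measurePreserving_add_left (volume : Measure (E m)) x).quasiMeasurePreserving.ae h1
        filter_upwards [h2] with z hz
        have h3 : HasFDerivAt (fun u => g (u + z)) (fderiv ℝ g (x + z)) x :=
          (hasFDerivAt_comp_add_right z).2 hz.hasFDerivAt
        exact h3.const_smul (ρ z)
    have hn : ∀ x ∈ Metric.ball y0 2, ‖∫ z, ρ z • fderiv ℝ g (x + z)‖ ≤ M := by
      intro x hx
      have : ∫ z, ρ z * M = M := by rw [integral_mul_const, hρ.int, one_mul]
      rw [← this]
      refine norm_integral_le_of_norm_le ?_ (Eventually.of_forall fun z => ?_)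
      · have := hρ.integrable (F := ℝ) (g := fun _ => M) continuous_const 0
        simpa using this
      rw [norm_smul, Real.norm_of_nonneg (hρ.nonneg z)]
      by_cases hz : r < ‖z‖
      · simp [hρ.supp z hz]
      refine mul_le_mul_of_nonneg_left ?_ (hρ.nonneg z)
      by_cases hdz : DifferentiableAt ℝ g (x + z)
      · refine hM _ ?_ hdz
        rw [Metric.mem_ball, dist_eq_norm] at hx ⊢
        have : x + z - y0 = (x - y0) + z := by abel
        rw [this]
        have := norm_add_le (x - y0) z
        linarith [not_lt.1 hz]
      · rw [fderiv_zero_of_not_differentiableAt hdz]; simpa using hM0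
    have h1 : ‖moll ρ g a - moll ρ g b‖ ≤ M * ‖a - b‖ := by
      refine Convex.norm_image_sub_le_of_norm_hasFDerivWithin_le (s := Metric.ball y0 2)
        (fun x _ => (hd x).hasFDerivWithinAt) hn (convex_ball _ _) ?_ ?_ <;>
      rw [Metric.mem_ball, dist_eq_norm] <;> linarith
    have h2 : ∀ x, |moll ρ g x - g x| ≤ K * r := by
      intro x
      have h3 : ∀ z : E m, ‖z‖ ≤ r → |g (x + z) - g x| ≤ K * r := by
        intro z hz
        have := hg.dist_le_mul (x + z) x
        rw [Real.dist_eq, dist_eq_norm, add_sub_cancel_left] at this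
        exact this.trans (mul_le_mul_of_nonneg_left hz K.coe_nonneg)
      rw [abs_le]
      constructor
      · have := hρ.le_moll hgc x (c := g x - K * r) fun z hz => by
          have := (abs_le.1 (h3 z hz)).1; linarith
        linarith
      · have := hρ.moll_le hgc x (c := g x + K * r) fun z hz => by
          have := (abs_le.1 (h3 z hz)).2; linarith
        linarith
    have ha2 := h2 a
    have hb2 := h2 b
    rw [Real.norm_eq_abs] at h1
    rw [abs_le] at *
    constructor <;> linarith [ha2.1, ha2.2, hb2.1, hb2.2, h1.1, h1.2]
  have hlim : Tendsto (fun r : ℝ => M * ‖a - b‖ + 2 * (K * r)) (𝓝[>] 0)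
      (𝓝 (M * ‖a - b‖ + 2 * (K * 0))) := by
    apply Tendsto.mono_left _ nhdsWithin_le_nhds
    exact Continuous.tendsto (by fun_prop) 0
  have := ge_of_tendsto hlim (by
    filter_upwards [Ioo_mem_nhdsGT (zero_lt_one' ℝ)] with r hr
    exact key r hr.1 hr.2.le)
  simpa using this

lemma f_pos {α f₀ : ℝ} (hf₀ : 0 < f₀) {f : E m → ℝ} (hH1 : H1 f α f₀) (y : E m) :
    f₀⁻¹ ≤ f y := by
  have h1 := (hH1 y).1
  have h2 : 0 ≤ ‖y‖ ^ α := Real.rpow_nonneg (norm_nonneg _) _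
  have h3 : 0 < f₀⁻¹ := inv_pos.2 hf₀
  nlinarith

lemma f_lip {α f₀ : ℝ} (hα : 0 < α) (hf₀ : 0 < f₀) {f : E m → ℝ} (hH0 : H0 f α f₀)
    (hH1 : H1 f α f₀) : ∃ L, 0 ≤ L ∧ ∀ y z : E m, ‖z‖ ≤ 1 → |f (y + z) - f y| ≤ L * ‖z‖ * f y := by
  obtain ⟨hl, -, hd⟩ := hH0
  have hfi : 0 < f₀⁻¹ := inv_pos.2 hf₀
  -- gradient bound
  have hb : ∃ L, 0 ≤ L ∧ ∀ y x : E m, ‖x - y‖ ≤ 3 → DifferentiableAt ℝ f x →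
      ‖fderiv ℝ f x‖ ≤ L * f y := by
    by_cases hα1 : α < 1
    · refine ⟨f₀ * f₀, by positivity, fun y x _ hx => ?_⟩
      have h1 := (hd x hx).2 hα1
      rw [norm_grad] at h1
      refine h1.trans ?_
      have h2 := f_pos hf₀ hH1 y
      have h3 : f₀ * f₀⁻¹ = 1 := mul_inv_cancel₀ hf₀.ne'
      nlinarith [mul_le_mul_of_nonneg_left h2 (mul_pos hf₀ hf₀).le]
    · push Not at hα1
      have hp : 0 < (4:ℝ) ^ (α - 1) := by positivity
      refine ⟨f₀ * f₀ * (2 * 4 ^ (α - 1) + 1), by positivity, fun y x hxy hx => ?_⟩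
      have h1 := (hd x hx).1 hα1
      rw [norm_grad] at h1
      refine h1.trans ?_
      have h2 := (hH1 y).1
      have hx1 : ‖x‖ ≤ ‖y‖ + 3 := by
        have := norm_add_le (x - y) y
        rw [sub_add_cancel] at this; linarith
      have h4 : ‖x‖ ^ (α - 1) ≤ 4 ^ (α - 1) * (‖y‖ ^ α + 1) := by
        rcases le_total ‖y‖ 1 with hy | hy
        · have : ‖x‖ ^ (α - 1) ≤ 4 ^ (α - 1) :=
            Real.rpow_le_rpow (norm_nonneg _) (by linarith) (by linarith)
          have h5 : 0 ≤ ‖y‖ ^ α := Real.rpow_nonneg (norm_nonneg _) _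
          nlinarith
        · have : ‖x‖ ^ (α - 1) ≤ (4 * ‖y‖) ^ (α - 1) :=
            Real.rpow_le_rpow (norm_nonneg _) (by linarith) (by linarith)
          rw [Real.mul_rpow (by norm_num) (norm_nonneg _)] at this
          have h6 : ‖y‖ ^ (α - 1) ≤ ‖y‖ ^ α := Real.rpow_le_rpow_of_exponent_le hy (by linarith)
          nlinarith
      have h5 : 0 ≤ ‖y‖ ^ α := Real.rpow_nonneg (norm_nonneg _) _
      have h7 : ‖y‖ ^ α + 1 ≤ f₀ * f y := by
        have := mul_le_mul_of_nonneg_left h2 hf₀.le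
        rwa [← mul_assoc, mul_inv_cancel₀ hf₀.ne', one_mul] at this
      have h8 : 1 + ‖x‖ ^ (α - 1) ≤ (2 * 4 ^ (α - 1) + 1) * (‖y‖ ^ α + 1) := by nlinarith
      calc f₀ * (1 + ‖x‖ ^ (α - 1)) ≤ f₀ * ((2 * 4 ^ (α - 1) + 1) * (‖y‖ ^ α + 1)) := by gcongr
        _ ≤ f₀ * ((2 * 4 ^ (α - 1) + 1) * (f₀ * f y)) := by gcongr
        _ = _ := by ring
  obtain ⟨L, hL0, hL⟩ := hb
  refine ⟨L, hL0, fun y z hz => ?_⟩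
  have hfy : 0 < f y := hfi.trans_le (f_pos hf₀ hH1 y)
  obtain ⟨K, hK⟩ := LocallyLipschitzOn.exists_lipschitzOnWith_of_compact
    (isCompact_closedBall y 3) hl.locallyLipschitzOn
  obtain ⟨g, hg, hgf⟩ := hK.extend_real
  have h1 := lip_ball hg y (M := L * f y) (by positivity) (a := y + z) (b := y) (fun x hx hdx => by
    have he : f =ᶠ[𝓝 x] g := by
      filter_upwards [Metric.isOpen_ball.mem_nhds hx] with u hu
      exact hgf (Metric.ball_subset_closedBall hu)
    rw [← he.fderiv_eq]
    rw [Metric.mem_ball, dist_eq_norm] at hx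
    exact hL y x hx.le (he.differentiableAt_iff.2 hdx)) (by simpa using hz) (by simp)
  rw [← hgf (x := y + z) (by simp; linarith), ← hgf (x := y) (by simp)] at h1
  rw [add_sub_cancel_left] at h1
  linarith

end Erg

open Filter MeasureTheory Topology

namespace Erg
variable {m : ℕ}

structure FData (f : E m → ℝ) (L c : ℝ) : Prop where
  cont : Continuous f
  c_pos : 0 < c
  low : ∀ y, c ≤ f y
  L0 : 0 ≤ L
  lip : ∀ y z : E m, ‖z‖ ≤ 1 → |f (y + z) - f y| ≤ L * ‖z‖ * f y
  coer : Tendsto f (cocompact (E m)) atTop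

structure Sol (θ : ℝ) (f : E m → ℝ) (lam : ℝ) (φ : E m → ℝ) : Prop where
  cd : ContDiff ℝ 2 φ
  one : ∀ y, 1 ≤ φ y
  eq : ∀ y, -(1/2) * lap φ y + (1/θ) * ‖fderiv ℝ φ y‖ ^ θ = f y - lam

lemma FData.pos {f : E m → ℝ} {L c : ℝ} (hf : FData f L c) (y : E m) : 0 < f y :=
  hf.c_pos.trans_le (hf.low y)

lemma FData.le {f : E m → ℝ} {L c : ℝ} (hf : FData f L c) (y z : E m) (hz : ‖z‖ ≤ 1) :
    f (y + z) ≤ (1 + L) * f y := by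
  have h1 := (abs_le.1 (hf.lip y z hz)).2
  have h2 := hf.pos y
  have h3 := hf.L0
  have : L * ‖z‖ * f y ≤ L * f y := by
    refine mul_le_mul_of_nonneg_right ?_ h2.le
    nlinarith
  linarith

lemma FData.le' {f : E m → ℝ} {L c : ℝ} (hf : FData f L c) (y z : E m) (hz : ‖z‖ ≤ 1) :
    f y ≤ (1 + L) * f (y + z) := by
  have := hf.le (y + z) (-z) (by rwa [norm_neg])
  rwa [add_neg_cancel_right] at this

lemma barrier {θ : ℝ} (hθ : 1 < θ) {f : E m → ℝ} {L c lam : ℝ} (hf : FData f L c) {φ : E m → ℝ}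
    (hφ : Sol θ f lam φ) : ∃ C, 0 < C ∧ ∀ y, f y ≤ C * φ y ^ θ := by
  have hL := hf.L0
  refine ⟨(1 + L) * (2 * m + 4 ^ θ + |lam|), by positivity, fun y => ?_⟩
  have hp := hφ.one y
  set k := 2 * φ y with hk
  obtain ⟨q1, q2, q3⟩ := quad_data 1 y
  have hbc : ContDiff ℝ 2 (fun x => k * quad 1 y x) := contDiff_const.mul q1
  have hcont : Continuous fun x => k * quad 1 y x - φ x := hbc.continuous.sub hφ.cd.continuous
  obtain ⟨x0, hx0, hmax⟩ := (isCompact_closedBall y 1).exists_isMaxOn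
    ⟨y, by simp⟩ hcont.continuousOn
  have hyv : k * quad 1 y y - φ y = φ y := by simp [quad, hk]; ring
  have hy0 : φ y ≤ k * quad 1 y x0 - φ x0 := by
    have := hmax (show y ∈ Metric.closedBall y 1 by simp)
    simp only [Set.mem_setOf_eq] at this
    linarith
  have hglob : ∀ x, k * quad 1 y x - φ x ≤ k * quad 1 y x0 - φ x0 := by
    intro x
    by_cases hx : x ∈ Metric.closedBall y 1
    · exact hmax hx
    · rw [Metric.mem_closedBall, dist_eq_norm, not_le] at hx
      have h1 : quad 1 y x ≤ 0 := by unfold quad; nlinarith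
      have h2 := hφ.one x
      nlinarith
  obtain ⟨e1, e2⟩ := max_sub hbc hφ.cd hglob
  rw [lap_const_mul q1, q3] at e2
  have hx0n : ‖x0 - y‖ ≤ 1 := by simpa [dist_eq_norm] using hx0
  have e3 : ‖fderiv ℝ φ x0‖ ≤ 4 * φ y := by
    rw [e1, fderiv_const_mul (q1.differentiable (by norm_num)).differentiableAt, norm_smul, q2,
      Real.norm_of_nonneg (by linarith)]
    nlinarith
  have e4 : ‖fderiv ℝ φ x0‖ ^ θ ≤ 4 ^ θ * φ y ^ θ := by
    rw [← Real.mul_rpow (by norm_num) (by linarith)]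
    exact Real.rpow_le_rpow (norm_nonneg _) e3 (by linarith)
  have e5 := hφ.eq x0
  have e6 : φ y ≤ φ y ^ θ := Real.self_le_rpow_of_one_le hp hθ.le
  have e7 : (1 / θ) * ‖fderiv ℝ φ x0‖ ^ θ ≤ ‖fderiv ℝ φ x0‖ ^ θ := by
    have : 1 / θ ≤ 1 := by rw [div_le_one (by linarith)]; exact hθ.le
    have h0 : 0 ≤ ‖fderiv ℝ φ x0‖ ^ θ := by positivity
    nlinarith
  have e8 : f x0 ≤ (2 * m + 4 ^ θ + |lam|) * φ y ^ θ := by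
    have h1 : lam ≤ |lam| * φ y ^ θ := (le_abs_self _).trans
      (by nlinarith [abs_nonneg lam])
    have h2 : (m : ℝ) * φ y ≤ m * φ y ^ θ := by gcongr
    nlinarith
  have e9 := hf.le x0 (y - x0) (by rwa [norm_sub_rev])
  rw [add_sub_cancel] at e9
  calc f y ≤ (1 + L) * f x0 := e9
    _ ≤ (1 + L) * ((2 * m + 4 ^ θ + |lam|) * φ y ^ θ) := by gcongr
    _ = _ := by ring

lemma sol_coercive {θ : ℝ} (hθ : 1 < θ) {f : E m → ℝ} {L c lam : ℝ} (hf : FData f L c)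
    {φ : E m → ℝ} (hφ : Sol θ f lam φ) : Tendsto φ (cocompact (E m)) atTop := by
  obtain ⟨C, hC, h⟩ := barrier hθ hf hφ
  rw [tendsto_atTop]
  intro b
  filter_upwards [hf.coer.eventually_gt_atTop (C * |b| ^ θ)] with y hy
  have h1 := hy.trans_le (h y)
  have h2 := lt_of_mul_lt_mul_left h1 hC.le
  have h3 := (Real.rpow_lt_rpow_iff (abs_nonneg b) (by linarith [hφ.one y]) (by linarith)).1 h2
  exact (le_abs_self b).trans h3.le

end Erg

open Filter MeasureTheory Topology

namespace Erg
variable {m : ℕ}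

lemma moll_eq {θ : ℝ} (hθ : 1 < θ) {f : E m → ℝ} {L c lam : ℝ} (hf : FData f L c)
    {ψ : E m → ℝ} (hψ : Sol θ f lam ψ) {r : ℝ} {ρ : E m → ℝ} (hρ : Ker r ρ) (y : E m) :
    -(1/2) * moll ρ (lap ψ) y + (1/θ) * moll ρ (fun x => ‖fderiv ℝ ψ x‖ ^ θ) y
      = moll ρ f y - lam := by
  have c1 := cont_lap hψ.cd
  have c2 : Continuous fun x => ‖fderiv ℝ ψ x‖ ^ θ :=
    (cont_fderiv hψ.cd).norm.rpow_const fun _ => Or.inr (by linarith)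
  have h1 : moll ρ f y - lam = moll ρ (fun x => f x - lam) y := by
    have := hρ.moll_const lam y
    conv_lhs => rw [← this]
    unfold moll
    rw [← integral_sub (hρ.integrable hf.cont y) (hρ.integrable continuous_const y)]
    congr 1; ext z; rw [smul_sub]
  rw [h1]
  have h2 : (fun x => f x - lam) = fun x => -(1/2) * lap ψ x + (1/θ) * ‖fderiv ℝ ψ x‖ ^ θ :=
    funext fun x => (hψ.eq x).symm
  rw [h2]
  unfold moll
  rw [← integral_const_mul, ← integral_const_mul, ← integral_add]
  · congr 1; ext z; simp only [smul_eq_mul]; ring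
  · exact (hρ.integrable c1 y).const_mul _
  · exact (hρ.integrable c2 y).const_mul _

lemma moll_A {θ : ℝ} (hθ : 1 < θ) {f : E m → ℝ} {L c lam : ℝ} (hf : FData f L c)
    {ψ : E m → ℝ} (hψ : Sol θ f lam ψ) {r : ℝ} (hr : r ≤ 1) {ρ : E m → ℝ} (hρ : Ker r ρ)
    (hρ1 : ContDiff ℝ 1 ρ) {K : ℝ} (hK : 0 ≤ K) (hKρ : ∀ z, ‖fderiv ℝ ρ z‖ ≤ K * ρ z ^ (1 / θ)) :
    ∃ C, 0 < C ∧ ∀ y, moll ρ (fun x => ‖fderiv ℝ ψ x‖ ^ θ) y ≤ C * f y := by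
  have hθ0 : 0 < θ := by linarith
  obtain ⟨q, hq⟩ : ∃ q, Real.HolderConjugate θ q := ⟨_, Real.HolderConjugate.conjExponent hθ⟩
  set K' := (m * K) ^ q / q with hK'
  have hK0 : 0 ≤ K' := div_nonneg (by positivity) hq.symm.pos.le
  set V := volume.real (Metric.closedBall (0 : E m) 1) with hV
  have hV0 : 0 ≤ V := measureReal_nonneg
  have hL := hf.L0
  have hc := hf.c_pos
  refine ⟨2 * θ * ((1 + L) + |lam| / c + K' * V / c), by positivity, fun y => ?_⟩
  have c2 : Continuous fun x => ‖fderiv ℝ ψ x‖ ^ θ :=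
    (cont_fderiv hψ.cd).norm.rpow_const fun _ => Or.inr (by linarith)
  set A := moll ρ (fun x => ‖fderiv ℝ ψ x‖ ^ θ) y with hA
  have e1 := moll_eq hθ hf hψ hρ y
  have e2 := hρ.moll_lap_le hρ1 hψ.cd y
  have e3 : moll ρ f y ≤ (1 + L) * f y := hρ.moll_le hf.cont y fun z hz => hf.le y z (hz.trans hr)
  have hind : Integrable (fun z => (Metric.closedBall (0 : E m) 1).indicator (fun _ => K') z) := by
    rw [integrable_indicator_iff measurableSet_closedBall]
    exact integrableOn_const (measure_closedBall_lt_top.ne)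
  have e4 : m * ∫ z, ‖fderiv ℝ ρ z‖ * ‖fderiv ℝ ψ (y + z)‖ ≤ (1 / θ) * A + K' * V := by
    have h1 : (1 / θ) * A + K' * V = ∫ z, ((1 / θ) * (ρ z • ‖fderiv ℝ ψ (y + z)‖ ^ θ) +
        (Metric.closedBall (0 : E m) 1).indicator (fun _ => K') z) := by
      rw [integral_add ((hρ.integrable c2 y).const_mul _) hind, integral_const_mul,
        integral_indicator_const _ measurableSet_closedBall, hA, hV, smul_eq_mul]
      unfold moll
      ring
    rw [h1, ← integral_const_mul]
    refine integral_mono_of_nonneg (Eventually.of_forall fun z => by positivity)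
      (((hρ.integrable c2 y).const_mul _).add hind) (Eventually.of_forall fun z => ?_)
    simp only [Pi.add_apply]
    by_cases hz : 1 < ‖z‖
    · have h0 : ρ z = 0 := hρ.supp z (hr.trans_lt hz)
      have h2 : ‖fderiv ℝ ρ z‖ = 0 := by
        have := hKρ z
        rw [h0, Real.zero_rpow (by positivity), mul_zero] at this
        exact le_antisymm this (norm_nonneg _)
      rw [h2, h0, Set.indicator_of_notMem (by simpa using hz)]
      simp
    · rw [Set.indicator_of_mem (by simpa using hz)]
      have hy := Real.young_inequality_of_nonneg (a := ρ z ^ (1 / θ) * ‖fderiv ℝ ψ (y + z)‖)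
        (b := m * K) (mul_nonneg (Real.rpow_nonneg (hρ.nonneg z) _) (norm_nonneg _))
        (by positivity) hq
      rw [Real.mul_rpow (Real.rpow_nonneg (hρ.nonneg z) _) (norm_nonneg _), ← Real.rpow_mul
        (hρ.nonneg z), one_div_mul_cancel hθ0.ne', Real.rpow_one] at hy
      calc m * (‖fderiv ℝ ρ z‖ * ‖fderiv ℝ ψ (y + z)‖)
          ≤ m * ((K * ρ z ^ (1 / θ)) * ‖fderiv ℝ ψ (y + z)‖) := by
            gcongr; exact hKρ z
        _ = ρ z ^ (1 / θ) * ‖fderiv ℝ ψ (y + z)‖ * (m * K) := by ring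
        _ ≤ _ := hy
        _ = _ := by rw [smul_eq_mul, hK']; ring
  have hfc : 1 ≤ f y / c := by rw [le_div_iff₀ hc, one_mul]; exact hf.low y
  have e5 : (1 / θ) * A ≤ 2 * ((1 + L) * f y + |lam| + K' * V) := by
    have := neg_abs_le lam
    have : 0 ≤ K' * V := by positivity
    linarith
  have e6 : |lam| ≤ |lam| / c * f y := by
    rw [div_mul_eq_mul_div, mul_div_assoc]
    nlinarith [abs_nonneg lam]
  have e7 : K' * V ≤ K' * V / c * f y := by
    have h1 := le_mul_of_one_le_right (mul_nonneg hK0 hV0) hfc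
    have h2 : K' * V / c * f y = K' * V * (f y / c) := by ring
    rw [h2]; exact h1
  have e8 : A = θ * ((1 / θ) * A) := by field_simp
  rw [e8]
  calc θ * ((1 / θ) * A) ≤ θ * (2 * ((1 + L) * f y + |lam| / c * f y + K' * V / c * f y)) := by
        apply mul_le_mul_of_nonneg_left _ hθ0.le; linarith
    _ = _ := by ring

lemma moll_one {θ : ℝ} {f : E m → ℝ} {lam : ℝ}
    {ψ : E m → ℝ} (hψ : Sol θ f lam ψ) {r : ℝ} {ρ : E m → ℝ} (hρ : Ker r ρ) (y : E m) :
    1 ≤ moll ρ ψ y := hρ.le_moll hψ.cd.continuous y fun z _ => hψ.one _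

lemma moll_low {θ : ℝ} (hθ : 1 < θ) {f : E m → ℝ} {L c lam : ℝ} (hf : FData f L c)
    {ψ : E m → ℝ} (hψ : Sol θ f lam ψ) {r : ℝ} (hr : r ≤ 1) {ρ : E m → ℝ} (hρ : Ker r ρ) :
    ∃ C, 0 < C ∧ ∀ y, f y ≤ C * moll ρ ψ y ^ θ := by
  have hθ0 : 0 < θ := by linarith
  have hL := hf.L0
  obtain ⟨C, hC, h⟩ := barrier hθ hf hψ
  have hD : 0 < (1 + L) * C := by positivity
  refine ⟨(1 + L) * C, hD, fun y => ?_⟩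
  have hp : 0 ≤ f y / ((1 + L) * C) := div_nonneg (hf.pos y).le hD.le
  have h1 : (f y / ((1 + L) * C)) ^ θ⁻¹ ≤ moll ρ ψ y := by
    refine hρ.le_moll hψ.cd.continuous y fun z hz => ?_
    have h2 := hf.le' y z (hz.trans hr)
    have h3 : f y / ((1 + L) * C) ≤ ψ (y + z) ^ θ := by
      rw [div_le_iff₀ hD]
      have := mul_le_mul_of_nonneg_left (h (y + z)) (by linarith : 0 ≤ 1 + L)
      nlinarith
    have h4 := Real.rpow_le_rpow hp h3 (inv_nonneg.2 hθ0.le)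
    rwa [Real.rpow_rpow_inv (by linarith [hψ.one (y + z)]) hθ0.ne'] at h4
  have h2 := Real.rpow_le_rpow (Real.rpow_nonneg hp _) h1 hθ0.le
  rw [Real.rpow_inv_rpow hp hθ0.ne', div_le_iff₀ hD] at h2
  linarith

lemma moll_grad {θ : ℝ} (hθ : 1 < θ) (hθ2 : θ < 2) {f : E m → ℝ} {L c lam : ℝ} (hf : FData f L c)
    {ψ : E m → ℝ} (hψ : Sol θ f lam ψ) {r : ℝ} (hr : r ≤ 1) {ρ : E m → ℝ} (hρ : Ker r ρ)
    (hρ1 : ContDiff ℝ 1 ρ) {K : ℝ} (hK : 0 ≤ K) (hKρ : ∀ z, ‖fderiv ℝ ρ z‖ ≤ K * ρ z ^ (1 / θ)) :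
    ∃ C, 0 < C ∧ ∀ y, ‖fderiv ℝ (moll ρ ψ) y‖ ^ 2 ≤ C * f y * moll ρ ψ y ^ (2 - θ) := by
  have hθ0 : 0 < θ := by linarith
  obtain ⟨C, hC, h1⟩ := moll_A hθ hf hψ hr hρ hρ1 hK hKρ
  obtain ⟨D, hD, h2⟩ := moll_low hθ hf hψ hr hρ
  obtain ⟨b1, b2, b3⟩ := hρ.moll_contDiff hψ.cd
  refine ⟨C * ((C * D) ^ θ⁻¹) ^ (2 - θ), by positivity, fun y => ?_⟩
  have hm := moll_one hψ hρ y
  rw [b2]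
  set p := ‖moll ρ (fderiv ℝ ψ) y‖ with hp
  have hp0 : 0 ≤ p := norm_nonneg _
  have h3 : p ^ θ ≤ C * f y := (hρ.jensen (cont_fderiv hψ.cd) hθ y).trans (h1 y)
  have h4 : p ≤ (C * D) ^ θ⁻¹ * moll ρ ψ y := by
    have h5 : p ^ θ ≤ ((C * D) ^ θ⁻¹ * moll ρ ψ y) ^ θ := by
      rw [Real.mul_rpow (by positivity) (by linarith), Real.rpow_inv_rpow (by positivity) hθ0.ne']
      have := mul_le_mul_of_nonneg_left (h2 y) hC.le
      linarith
    exact (Real.rpow_le_rpow_iff hp0 (by positivity) hθ0).1 h5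
  have h6 : p ^ (2 - θ) ≤ ((C * D) ^ θ⁻¹) ^ (2 - θ) * moll ρ ψ y ^ (2 - θ) := by
    rw [← Real.mul_rpow (by positivity) (by linarith)]
    exact Real.rpow_le_rpow hp0 h4 (by linarith)
  have h7 : p ^ 2 = p ^ θ * p ^ (2 - θ) := by
    rw [← Real.rpow_add_of_nonneg hp0 hθ0.le (by linarith), ← Real.rpow_natCast]
    norm_num
  rw [h7]
  have hfp := hf.pos y
  calc p ^ θ * p ^ (2 - θ) ≤ (C * f y) * (((C * D) ^ θ⁻¹) ^ (2 - θ) * moll ρ ψ y ^ (2 - θ)) := by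
        gcongr
    _ = _ := by ring

end Erg

open Filter MeasureTheory Topology

namespace Erg
variable {m : ℕ}

lemma exp_aux {θ η t : ℝ} (hθ : 1 < θ) (hθ2 : θ < 2) (hη : 0 < η) (ht : 0 ≤ t) :
    η * Real.exp (-η * t) * t ^ (2 - θ) ≤ η ^ (θ - 1) := by
  have hx : 0 ≤ η * t := by positivity
  have h1 : (η * t) ^ (2 - θ) ≤ Real.exp (η * t) := by
    calc (η * t) ^ (2 - θ) ≤ (1 + η * t) ^ (2 - θ) :=
          Real.rpow_le_rpow hx (by linarith) (by linarith)
      _ ≤ (1 + η * t) ^ (1 : ℝ) := Real.rpow_le_rpow_of_exponent_le (by linarith) (by linarith)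
      _ = η * t + 1 := by rw [Real.rpow_one]; ring
      _ ≤ _ := Real.add_one_le_exp _
  rw [Real.mul_rpow hη.le ht] at h1
  have h2 : η = η ^ (θ - 1) * η ^ (2 - θ) := by
    rw [← Real.rpow_add hη]
    have : θ - 1 + (2 - θ) = 1 := by ring
    rw [this, Real.rpow_one]
  have h3 : Real.exp (-η * t) * Real.exp (η * t) = 1 := by
    rw [← Real.exp_add]; simp
  have h4 := mul_le_mul_of_nonneg_left h1 (Real.exp_pos (-η * t)).le
  rw [h3] at h4
  have h5 : 0 ≤ η ^ (θ - 1) := by positivity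
  calc η * Real.exp (-η * t) * t ^ (2 - θ)
      = η ^ (θ - 1) * (Real.exp (-η * t) * (η ^ (2 - θ) * t ^ (2 - θ))) := by
        conv_lhs => rw [h2]
        have : Real.exp (-(η ^ (θ - 1) * η ^ (2 - θ)) * t) = Real.exp (-η * t) := by rw [← h2]
        rw [this]; ring
    _ ≤ η ^ (θ - 1) * 1 := mul_le_mul_of_nonneg_left h4 h5
    _ = _ := mul_one _

noncomputable def hh (s η t : ℝ) : ℝ := s / η * (1 - Real.exp (-η * t))

lemma hh_deriv (s : ℝ) {η : ℝ} (hη : 0 < η) (t : ℝ) :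
    HasDerivAt (hh s η) (s * Real.exp (-η * t)) t := by
  have h1 : HasDerivAt (fun t : ℝ => -η * t) (-η) t := by
    simpa using (hasDerivAt_id t).const_mul (-η)
  have h2 := (h1.exp.const_sub 1).const_mul (s / η)
  refine h2.congr_deriv ?_
  field_simp

lemma hh_deriv2 (s η t : ℝ) :
    HasDerivAt (fun t => s * Real.exp (-η * t)) (-(s * η * Real.exp (-η * t))) t := by
  have h1 : HasDerivAt (fun t : ℝ => -η * t) (-η) t := by
    simpa using (hasDerivAt_id t).const_mul (-η)
  have h2 := h1.exp.const_mul s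
  refine h2.congr_deriv ?_
  ring

set_option maxHeartbeats 1600000 in
lemma bounded_key {θ : ℝ} (hθ : 1 < θ) (hθ2 : θ < 2) {f : E m → ℝ} {L c lam1 lam2 : ℝ}
    (hf : FData f L c) {φ ψ : E m → ℝ} (hφ : Sol θ f lam1 φ) (hψ : Sol θ f lam2 ψ)
    {s : ℝ} (hs : 0 < s) (hs1 : s < 1) {R M : ℝ}
    (hR : ∀ y, (1 - s) / 2 * f y ≤ |lam1| + |lam2| → ‖y‖ ≤ R)
    (hM : ∀ x, ‖x‖ ≤ R + 1 → ψ x ≤ M)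
    {r : ℝ} (hr : r ≤ 1) (hr0 : 0 < r) (hsr : s * L * r ≤ (1 - s) / 4) {ρ : E m → ℝ}
    (hρ : Ker r ρ)
    (hρ1 : ContDiff ℝ 1 ρ) {K : ℝ} (hK : 0 ≤ K) (hKρ : ∀ z, ‖fderiv ℝ ρ z‖ ≤ K * ρ z ^ (1 / θ)) :
    ∃ η0, 0 < η0 ∧ ∀ η, 0 < η → η ≤ η0 → ∀ y, hh s η (moll ρ ψ y) - φ y ≤ s * M := by
  have hθ0 : 0 < θ := by linarith
  obtain ⟨C, hC, hP⟩ := moll_grad hθ hθ2 hf hψ hr hρ hρ1 hK hKρ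
  obtain ⟨b1, b2, b3⟩ := hρ.moll_contDiff hψ.cd
  have hs2 : 0 < 1 - s := by linarith
  refine ⟨((1 - s) / (2 * C)) ^ (θ - 1)⁻¹, by positivity, fun η hη hη0 => ?_⟩
  have hηp : η ^ (θ - 1) ≤ (1 - s) / (2 * C) := by
    have := Real.rpow_le_rpow hη.le hη0 (by linarith : 0 ≤ θ - 1)
    rwa [Real.rpow_inv_rpow (by positivity) (by linarith)] at this
  obtain ⟨g1, g2, g3⟩ := comp_data b1 (hh_deriv s hη) (hh_deriv2 s η) (by fun_prop)
  have hlim : Tendsto (fun y => hh s η (moll ρ ψ y) - φ y) (cocompact (E m)) atBot := by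
    have h1 := tendsto_neg_atTop_atBot.comp (sol_coercive hθ hf hφ)
    have h2 := tendsto_atBot_add_left_of_ge (cocompact (E m)) (f := fun y => hh s η (moll ρ ψ y))
      (s / η) (fun y => by
        unfold hh
        have := Real.exp_pos (-η * moll ρ ψ y)
        have h3 : 0 < s / η := by positivity
        nlinarith) h1
    refine h2.congr fun y => ?_
    simp [sub_eq_add_neg]
  obtain ⟨y0, hy0⟩ := (g1.continuous.sub hφ.cd.continuous).exists_forall_ge hlim
  obtain ⟨e1, e2⟩ := max_sub g1 hφ.cd hy0
  rw [g2] at e1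
  rw [g3] at e2
  have hmo := moll_one hψ hρ y0
  set t := moll ρ ψ y0 with ht
  set e := Real.exp (-η * t) with he
  have he0 : 0 < e := Real.exp_pos _
  have he1 : e ≤ 1 := Real.exp_le_one_iff.2 (by nlinarith)
  set p := ‖fderiv ℝ (moll ρ ψ) y0‖ with hp
  have hp0 : 0 ≤ p := norm_nonneg _
  have hfp := hf.pos y0
  have hse : s * e ≤ s := by nlinarith
  have hse0 : 0 < s * e := by positivity
  have n1 : ‖fderiv ℝ φ y0‖ ^ θ ≤ s * e * p ^ θ := by
    rw [e1, norm_smul, Real.norm_of_nonneg hse0.le, Real.mul_rpow hse0.le hp0]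
    refine mul_le_mul_of_nonneg_right ?_ (by positivity)
    calc (s * e) ^ θ ≤ (s * e) ^ (1:ℝ) :=
          Real.rpow_le_rpow_of_exponent_ge hse0 (by linarith) hθ.le
      _ = _ := Real.rpow_one _
  set A := moll ρ (fun x => ‖fderiv ℝ ψ x‖ ^ θ) y0 with hA
  have n2 : p ^ θ ≤ A := by
    rw [hp, b2]; exact hρ.jensen (cont_fderiv hψ.cd) hθ y0
  have n3 : -(1/2) * lap (moll ρ ψ) y0 + (1/θ) * A = moll ρ f y0 - lam2 := by
    rw [b3]; exact moll_eq hθ hf hψ hρ y0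
  have n4 : moll ρ f y0 ≤ (1 + L * r) * f y0 := by
    refine hρ.moll_le hf.cont y0 fun z hz => ?_
    have h1 := (abs_le.1 (hf.lip y0 z (hz.trans hr))).2
    have h2 : L * ‖z‖ * f y0 ≤ L * r * f y0 := by
      have := hf.L0
      gcongr
    linarith
  have n5 := hφ.eq y0
  have n6 : s * η * e * p ^ 2 ≤ (1 - s) / 2 * f y0 := by
    have h1 := exp_aux hθ hθ2 hη (by linarith : 0 ≤ t)
    have h2 := hP y0
    calc s * η * e * p ^ 2 ≤ 1 * η * e * (C * f y0 * t ^ (2 - θ)) := by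
          gcongr
      _ = C * f y0 * (η * e * t ^ (2 - θ)) := by ring
      _ ≤ C * f y0 * ((1 - s) / (2 * C)) := by
          apply mul_le_mul_of_nonneg_left (h1.trans hηp) (by positivity)
      _ = _ := by field_simp
  have n7 : (1/θ) * ‖fderiv ℝ φ y0‖ ^ θ ≤ s * e * ((1/θ) * A) := by
    have : s * e * p ^ θ ≤ s * e * A := by gcongr
    calc (1/θ) * ‖fderiv ℝ φ y0‖ ^ θ ≤ (1/θ) * (s * e * A) := by gcongr; linarith
      _ = _ := by ring
  have n8 : f y0 - lam1 ≤ s * e * (moll ρ f y0 - lam2) + (1 - s) / 4 * f y0 := by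
    rw [← n3]; nlinarith
  have n9 : s * e * moll ρ f y0 ≤ s * f y0 + (1 - s) / 4 * f y0 := by
    have hL := hf.L0
    calc s * e * moll ρ f y0 ≤ s * e * ((1 + L * r) * f y0) := by gcongr
      _ ≤ s * ((1 + L * r) * f y0) := by
          apply mul_le_mul_of_nonneg_right hse (by positivity)
      _ = s * f y0 + (s * L * r) * f y0 := by ring
      _ ≤ _ := by gcongr
  have n10 : -(s * e * lam2) ≤ |lam2| := by
    have h1 := neg_abs_le lam2
    have h2 := abs_nonneg lam2
    nlinarith
  have n11 : ‖y0‖ ≤ R := hR y0 (by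
    have := le_abs_self lam1
    nlinarith)
  have n12 : t ≤ M := hρ.moll_le hψ.cd.continuous y0 fun z hz => hM _ (by
    have := norm_add_le y0 z; linarith)
  intro y
  refine (hy0 y).trans ?_
  have n13 : hh s η t ≤ s * t := by
    have h1 := Real.add_one_le_exp (-η * t)
    have h3 : 0 < s / η := by positivity
    have h4 : s * t = s / η * (η * t) := by field_simp
    unfold hh
    rw [h4]
    apply mul_le_mul_of_nonneg_left _ h3.le
    linarith
  have n14 := hφ.one y0
  have : s * t ≤ s * M := by gcongr
  change hh s η t - φ y0 ≤ _
  linarith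

lemma bounded_diff {θ : ℝ} (hθ : 1 < θ) (hθ2 : θ < 2) {f : E m → ℝ} {L c lam1 lam2 : ℝ}
    (hf : FData f L c) {φ ψ : E m → ℝ} (hφ : Sol θ f lam1 φ) (hψ : Sol θ f lam2 ψ)
    {s : ℝ} (hs : 0 < s) (hs1 : s < 1) : ∃ C, ∀ y, s * ψ y - φ y ≤ C := by
  have hs2 : 0 < 1 - s := by linarith
  obtain ⟨R, hR⟩ : ∃ R, ∀ y, (1 - s) / 2 * f y ≤ |lam1| + |lam2| → ‖y‖ ≤ R := by
    have h1 := hf.coer.eventually_gt_atTop ((|lam1| + |lam2|) / ((1 - s) / 2))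
    obtain ⟨k, hk, hk2⟩ := mem_cocompact.1 h1
    obtain ⟨R, hR⟩ := hk.isBounded.exists_norm_le
    refine ⟨R, fun y hy => hR y ?_⟩
    by_contra hyk
    have := hk2 hyk
    simp only [Set.mem_setOf_eq] at this
    rw [div_lt_iff₀ (by positivity)] at this
    linarith
  obtain ⟨M, hM⟩ := (isCompact_closedBall (0 : E m) (R + 1)).exists_bound_of_continuousOn
    hψ.cd.continuous.continuousOn
  have hM' : ∀ x, ‖x‖ ≤ R + 1 → ψ x ≤ M := fun x hx =>
    (le_abs_self _).trans (hM x (by simpa using hx))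
  have hL := hf.L0
  obtain ⟨r0, hr0, hr01, hr0L⟩ : ∃ r0 : ℝ, 0 < r0 ∧ r0 ≤ 1 ∧ s * L * r0 ≤ (1 - s) / 4 := by
    refine ⟨min 1 ((1 - s) / 4 / (L + 1)), by positivity, min_le_left _ _, ?_⟩
    calc s * L * min 1 ((1 - s) / 4 / (L + 1)) ≤ 1 * (L + 1) * ((1 - s) / 4 / (L + 1)) := by
          gcongr
          · linarith
          · exact min_le_right _ _
      _ = _ := by field_simp
  refine ⟨s * M, fun y => ?_⟩
  refine le_of_forall_pos_le_add fun ε hε => ?_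
  obtain ⟨δ, hδ, hδ2⟩ := Metric.continuousAt_iff.1 (hψ.cd.continuous.continuousAt (x := y)) ε hε
  set r := min r0 (δ / 2) with hr
  have hrp : 0 < r := by positivity
  have hr1 : r ≤ 1 := (min_le_left _ _).trans hr01
  have hrL : s * L * r ≤ (1 - s) / 4 := le_trans (by gcongr; exact min_le_left _ _) hr0L
  obtain ⟨ρ, hρ, hρ1, K, hK, hKρ⟩ := exists_ker (m := m) hθ hrp hr1
  obtain ⟨η0, hη0, hk⟩ := bounded_key hθ hθ2 hf hφ hψ hs hs1 hR hM' hr1 hrp hrL hρ hρ1 hK hKρ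
  have h1 : ψ y - ε ≤ moll ρ ψ y := hρ.le_moll hψ.cd.continuous y fun z hz => by
    have : dist (y + z) y < δ := by
      rw [dist_eq_norm, add_sub_cancel_left]
      have : r ≤ δ / 2 := min_le_right _ _
      linarith
    have h2 := hδ2 this
    rw [Real.dist_eq, abs_lt] at h2
    linarith
  have hmo := moll_one hψ hρ y
  set t := moll ρ ψ y with ht
  have h2 : s * t - φ y ≤ s * M := by
    have hlim : Tendsto (fun η : ℝ => s * M + s * η * t ^ 2) (𝓝[>] 0)
        (𝓝 (s * M + s * 0 * t ^ 2)) := by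
      apply Tendsto.mono_left _ nhdsWithin_le_nhds
      exact Continuous.tendsto (by fun_prop) 0
    have := ge_of_tendsto hlim (b := s * t - φ y) (by
      filter_upwards [Ioo_mem_nhdsGT hη0] with η hη
      have h3 := hk η hη.1 hη.2.le y
      rw [← ht] at h3
      have hη1 := hη.1
      have h4 : Real.exp (-η * t) ≤ 1 - η * t + (η * t) ^ 2 := by
        have hx : 0 ≤ η * t := by positivity
        have h5 : Real.exp (-η * t) * Real.exp (η * t) = 1 := by
          rw [← Real.exp_add]; simp
        have h6 := Real.add_one_le_exp (η * t)
        have h7 := Real.exp_pos (-η * t)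
        have h8 : Real.exp (-η * t) * (1 + η * t) ≤ 1 := by nlinarith
        have h9 : 1 ≤ (1 - η * t + (η * t) ^ 2) * (1 + η * t) := by
          have : 0 ≤ (η * t) ^ 3 := by positivity
          nlinarith
        exact le_of_mul_le_mul_right (h8.trans h9) (by linarith)
      have h5 : s * t - s * η * t ^ 2 ≤ hh s η t := by
        have h6 : 0 < s / η := by positivity
        have h7 : s * t - s * η * t ^ 2 = s / η * (η * t - (η * t) ^ 2) := by field_simp
        rw [h7]
        unfold hh
        apply mul_le_mul_of_nonneg_left _ h6.le
        linarith
      linarith)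
    simpa using this
  nlinarith

end Erg

open Filter MeasureTheory Topology

namespace Erg
variable {m : ℕ}

lemma coercive_diff {θ : ℝ} (hθ : 1 < θ) (hθ2 : θ < 2) {f : E m → ℝ} {L c lam1 lam2 : ℝ}
    (hf : FData f L c) {φ ψ : E m → ℝ} (hφ : Sol θ f lam1 φ) (hψ : Sol θ f lam2 ψ)
    {s : ℝ} (hs : 0 < s) (hs1 : s < 1) :
    Tendsto (fun y => s * ψ y - φ y) (cocompact (E m)) atBot := by
  obtain ⟨C, hC⟩ := bounded_diff hθ hθ2 hf hφ hψ (s := (1 + s) / 2) (by linarith) (by linarith)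
  have ha : 0 < s / ((1 + s) / 2) := by positivity
  have hb : 0 < 1 - s / ((1 + s) / 2) := by
    rw [sub_pos, div_lt_one (by linarith)]; linarith
  have h1 : Tendsto (fun y => (1 - s / ((1 + s) / 2)) * φ y) (cocompact (E m)) atTop :=
    (sol_coercive hθ hf hφ).const_mul_atTop hb
  have h2 := tendsto_atBot_add_const_left _ (s / ((1 + s) / 2) * C)
    (tendsto_neg_atTop_atBot.comp h1)
  refine tendsto_atBot_mono (fun y => ?_) h2
  have h3 := mul_le_mul_of_nonneg_left (hC y) ha.le
  have h4 : s / ((1 + s) / 2) * ((1 + s) / 2 * ψ y - φ y) = s * ψ y - s / ((1 + s) / 2) * φ y := by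
    field_simp
  simp only [Function.comp]
  rw [h4] at h3
  linarith

lemma lam_le {θ : ℝ} (hθ : 1 < θ) (hθ2 : θ < 2) {f : E m → ℝ} {L c lam1 lam2 : ℝ}
    (hf : FData f L c) {φ ψ : E m → ℝ} (hφ : Sol θ f lam1 φ) (hψ : Sol θ f lam2 ψ) :
    lam2 ≤ lam1 := by
  have key : ∀ s : ℝ, 0 < s → s < 1 → s * lam2 ≤ lam1 := by
    intro s hs hs1
    have hcd : ContDiff ℝ 2 fun y => s * ψ y := contDiff_const.mul hψ.cd
    obtain ⟨x, hx⟩ := (hcd.continuous.sub hφ.cd.continuous).exists_forall_ge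
      (coercive_diff hθ hθ2 hf hφ hψ hs hs1)
    obtain ⟨e1, e2⟩ := max_sub hcd hφ.cd hx
    rw [lap_const_mul hψ.cd] at e2
    rw [fderiv_const_mul (diff1 hψ.cd x)] at e1
    have n1 : ‖fderiv ℝ φ x‖ ^ θ ≤ s * ‖fderiv ℝ ψ x‖ ^ θ := by
      rw [e1, norm_smul, Real.norm_of_nonneg hs.le, Real.mul_rpow hs.le (norm_nonneg _)]
      refine mul_le_mul_of_nonneg_right ?_ (by positivity)
      calc s ^ θ ≤ s ^ (1:ℝ) := Real.rpow_le_rpow_of_exponent_ge hs hs1.le hθ.le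
        _ = _ := Real.rpow_one _
    have n2 : (1/θ) * ‖fderiv ℝ φ x‖ ^ θ ≤ s * ((1/θ) * ‖fderiv ℝ ψ x‖ ^ θ) := by
      calc (1/θ) * ‖fderiv ℝ φ x‖ ^ θ ≤ (1/θ) * (s * ‖fderiv ℝ ψ x‖ ^ θ) := by gcongr
        _ = _ := by ring
    have n3 := hφ.eq x
    have n4 := hψ.eq x
    have n5 : f x - lam1 ≤ s * (f x - lam2) := by rw [← n3, ← n4]; linarith
    have := hf.pos x
    nlinarith
  have hlim : Tendsto (fun s : ℝ => s * lam2) (𝓝[<] 1) (𝓝 (1 * lam2)) := by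
    apply Tendsto.mono_left _ nhdsWithin_le_nhds
    exact Continuous.tendsto (by fun_prop) 1
  have := le_of_tendsto hlim (b := lam1) (by
    filter_upwards [Ioo_mem_nhdsLT (zero_lt_one' ℝ)] with s hs
    exact key s hs.1 hs.2)
  simpa using this

lemma bump_G {R δ b : ℝ} (hδ : 0 < δ) (hR : 0 < R) (hb : 0 ≤ b) (z : E m) :
    ∃ k : ℕ, ∀ x, δ ≤ ‖x - z‖ → pp (k + 2) (quad (R ^ 2) z x) ≤
      (1 / 2) * lap (bump k R z) x - b * ‖fderiv ℝ (bump k R z) x‖ := by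
  obtain ⟨k, hk⟩ := exists_nat_ge ((1 + m * R ^ 2 + 2 * b * R ^ 2 * R) / (2 * δ ^ 2))
  rw [div_le_iff₀ (by positivity)] at hk
  refine ⟨k, fun x hx => ?_⟩
  obtain ⟨-, b2, b3⟩ := bump_data k R z
  rw [b2, b3]
  rcases le_total R ‖x - z‖ with h | h
  · have h0 := bump_zero 0 hR.le h
    rw [h0 (k + 1), h0 (k + 2)]; simp
  · set t := ‖x - z‖ with ht
    have hq : quad (R ^ 2) z x = R ^ 2 - t ^ 2 := rfl
    have hq0 : 0 ≤ R ^ 2 - t ^ 2 := by nlinarith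
    rw [hq, pp_of_nonneg _ hq0, pp_of_nonneg _ hq0]
    set q := R ^ 2 - t ^ 2 with hqd
    have ht0 : 0 ≤ t := norm_nonneg _
    have hqR : q ≤ R ^ 2 := by nlinarith
    have h1 : (1:ℝ) ≤ 2 * (k + 3) * t ^ 2 - m * q - 2 * b * q * t := by
      have a1 : (m : ℝ) * q ≤ m * R ^ 2 := by gcongr
      have a2 : 2 * b * q * t ≤ 2 * b * R ^ 2 * R := by gcongr
      have a3 : δ ^ 2 ≤ t ^ 2 := by gcongr
      have a4 : (k : ℝ) * (2 * δ ^ 2) ≤ k * (2 * t ^ 2) := by gcongr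
      nlinarith [sq_nonneg t]
    have h2 : 0 ≤ q ^ (k + 2) := by positivity
    have h3 : q ^ (k + 3) = q ^ (k + 2) * q := pow_succ _ _
    rw [h3]
    have h4 : 1 / 2 * ((k + 4) * (q ^ (k + 2) * q) * (-2 * m) +
        (k + 4) * (k + 3) * q ^ (k + 2) * (4 * t ^ 2)) -
        b * ((k + 4) * (q ^ (k + 2) * q) * (2 * t)) =
        (q ^ (k + 2) * (k + 4)) * (2 * (k + 3) * t ^ 2 - m * q - 2 * b * q * t) := by ring
    rw [h4]
    have h5 : q ^ (k + 2) ≤ q ^ (k + 2) * (k + 4) := by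
      have : (0:ℝ) ≤ k := Nat.cast_nonneg k
      nlinarith
    nlinarith

set_option maxHeartbeats 1600000 in
lemma w_le {θ : ℝ} (hθ : 1 < θ) (hθ2 : θ < 2) {f : E m → ℝ} {L c lam : ℝ}
    (hf : FData f L c) {φ ψ : E m → ℝ} (hφ : Sol θ f lam φ) (hψ : Sol θ f lam ψ) (y z : E m) :
    ψ y - φ y ≤ ψ z - φ z := by
  by_contra hcon
  push Not at hcon
  have hθ0 : 0 < θ := by linarith
  obtain ⟨ε, hε, hεw⟩ : ∃ ε, 0 < ε ∧ ψ z - φ z < ψ y - φ y - 3 * ε :=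
    ⟨(ψ y - φ y - (ψ z - φ z)) / 4, by linarith, by linarith⟩
  have hwc : Continuous fun x => ψ x - φ x := hψ.cd.continuous.sub hφ.cd.continuous
  obtain ⟨δ, hδ, hδw⟩ : ∃ δ, 0 < δ ∧ ∀ x, ‖x - z‖ < δ → ψ x - φ x < ψ y - φ y - 3 * ε := by
    have := (hwc.tendsto z).eventually (gt_mem_nhds hεw)
    obtain ⟨δ, hδ, h⟩ := Metric.eventually_nhds_iff.1 this
    exact ⟨δ, hδ, fun x hx => h (by rwa [dist_eq_norm])⟩
  obtain ⟨R', hR'0, hR'⟩ : ∃ R', 0 < R' ∧ ∀ x, R' ≤ ‖x - z‖ → lam < f x := by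
    have h1 := hf.coer.eventually_gt_atTop lam
    obtain ⟨k, hk, hk2⟩ := mem_cocompact.1 h1
    obtain ⟨R, hR⟩ := hk.isBounded.exists_norm_le
    refine ⟨|R| + ‖z‖ + 1, by positivity, fun x hx => ?_⟩
    have hxk : x ∉ k := fun hxk => by
      have h2 := hR x hxk
      have h3 := norm_sub_le x z
      have h4 := le_abs_self R
      linarith
    exact hk2 hxk
  set R := R' + 1 with hRd
  have hR : 0 < R := by linarith
  obtain ⟨B0, hB0⟩ := (isCompact_closedBall z R).exists_bound_of_continuousOn
    (cont_fderiv hψ.cd).continuousOn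
  set B := |B0| + 1 with hB
  have hBp : 0 < B := by positivity
  set b := B ^ (θ - 1) with hb
  have hb0 : 0 < b := by positivity
  obtain ⟨k, hG⟩ := bump_G hδ hR hb0.le z
  obtain ⟨b1, b2, b3⟩ := bump_data k R z
  set χ : E m → ℝ := bump k R z with hχ
  have hχ0 : ∀ x, 0 ≤ χ x := fun x => bump_nonneg _ _ _ _
  have hout : ∀ x, R ≤ ‖x - z‖ → χ x = 0 ∧ ‖fderiv ℝ χ x‖ = 0 := by
    intro x hx
    have h0 := bump_zero 0 hR.le hx
    refine ⟨h0 (k + 3), ?_⟩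
    rw [b2, h0 (k + 2)]; simp
  obtain ⟨X, hX0, hX⟩ : ∃ X, 0 ≤ X ∧ ∀ x, χ x ≤ X := by
    obtain ⟨X, hX⟩ := (isCompact_closedBall z R).exists_bound_of_continuousOn
      b1.continuous.continuousOn
    refine ⟨|X|, abs_nonneg _, fun x => ?_⟩
    rcases le_total R ‖x - z‖ with h | h
    · rw [(hout x h).1]; positivity
    · exact (le_abs_self _).trans ((hX x (by simpa [dist_eq_norm] using h)).trans (le_abs_self _))
  obtain ⟨Y, hY0, hY⟩ : ∃ Y, 0 ≤ Y ∧ ∀ x, ‖fderiv ℝ χ x‖ ≤ Y := by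
    obtain ⟨Y, hY⟩ := (isCompact_closedBall z R).exists_bound_of_continuousOn
      (cont_fderiv b1).continuousOn
    refine ⟨|Y|, abs_nonneg _, fun x => ?_⟩
    rcases le_total R ‖x - z‖ with h | h
    · rw [(hout x h).2]; positivity
    · exact (hY x (by simpa [dist_eq_norm] using h)).trans (le_abs_self _)
  obtain ⟨τ, hτ, hτX, hτY⟩ : ∃ τ, 0 < τ ∧ τ * X ≤ ε ∧ τ * Y ≤ 1 := by
    refine ⟨min (ε / (X + 1)) (1 / (Y + 1)), by positivity, ?_, ?_⟩
    · calc min (ε / (X + 1)) (1 / (Y + 1)) * X ≤ ε / (X + 1) * (X + 1) := by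
            gcongr
            · exact min_le_left _ _
            · linarith
        _ = ε := by field_simp
    · calc min (ε / (X + 1)) (1 / (Y + 1)) * Y ≤ 1 / (Y + 1) * (Y + 1) := by
            gcongr
            · exact min_le_right _ _
            · linarith
        _ = 1 := by field_simp
  have hψy := hψ.one y
  obtain ⟨s, hs0, hs1, hsl, hsy⟩ : ∃ s, 0 < s ∧ s < 1 ∧ (1 - s) * |lam| < τ ∧ (1 - s) * ψ y ≤ ε := by
    obtain ⟨κ, hκ, h1, h2, h3⟩ : ∃ κ : ℝ, 0 < κ ∧ κ ≤ 1 / 2 ∧ κ * (|lam| + 1) ≤ τ ∧ κ * ψ y ≤ ε := by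
      have hψ0 : 0 < ψ y := by linarith
      refine ⟨min (1 / 2) (min (τ / (|lam| + 1)) (ε / ψ y)), by positivity, min_le_left _ _, ?_, ?_⟩
      · rw [← le_div_iff₀ (by positivity)]
        exact (min_le_right _ _).trans (min_le_left _ _)
      · rw [← le_div_iff₀ hψ0]
        exact (min_le_right _ _).trans (min_le_right _ _)
    refine ⟨1 - κ, by linarith, by linarith, ?_, ?_⟩ <;> rw [sub_sub_cancel]
    · nlinarith
    · exact h3
  have cd1 : ContDiff ℝ 2 fun x => s * ψ x := contDiff_const.mul hψ.cd
  have cd2 : ContDiff ℝ 2 fun x => τ * χ x := contDiff_const.mul b1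
  have cd3 : ContDiff ℝ 2 fun x => s * ψ x + τ * χ x := cd1.add cd2
  have hlim : Tendsto (fun x => s * ψ x + τ * χ x - φ x) (cocompact (E m)) atBot := by
    have h1 := tendsto_atBot_add_const_left _ ε (coercive_diff hθ hθ2 hf hφ hψ hs0 hs1)
    refine tendsto_atBot_mono (fun x => ?_) h1
    have : τ * χ x ≤ τ * X := mul_le_mul_of_nonneg_left (hX x) hτ.le
    linarith
  obtain ⟨x0, hx0⟩ := (cd3.continuous.sub hφ.cd.continuous).exists_forall_ge hlim
  obtain ⟨e1, e2⟩ := max_sub cd3 hφ.cd hx0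
  rw [lap_add cd1 cd2, lap_const_mul hψ.cd, lap_const_mul b1] at e2
  rw [fderiv_fun_add (diff1 cd1 x0) (diff1 cd2 x0), fderiv_const_mul (diff1 hψ.cd x0),
    fderiv_const_mul (diff1 b1 x0)] at e1
  set p := ‖fderiv ℝ ψ x0‖ with hp
  set d := ‖fderiv ℝ χ x0‖ with hd
  have hp0 : 0 ≤ p := norm_nonneg _
  have hd0 : 0 ≤ d := norm_nonneg _
  have hT : ‖fderiv ℝ φ x0‖ ≤ s * p + τ * d := by
    rw [e1]
    refine (norm_add_le _ _).trans (le_of_eq ?_)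
    rw [norm_smul, norm_smul, Real.norm_of_nonneg hs0.le, Real.norm_of_nonneg hτ.le]
  set T := s * p + τ * d with hTd
  have hT0 : 0 ≤ T := by positivity
  have n1 : T ^ θ ≤ s * p ^ θ + θ * (b * (τ * d)) := by
    have t1 := tangent hθ (a := s * p) (t := T) (by positivity) hT0
    have t2 : (s * p) ^ θ ≤ s * p ^ θ := by
      rw [Real.mul_rpow hs0.le hp0]
      refine mul_le_mul_of_nonneg_right ?_ (by positivity)
      calc s ^ θ ≤ s ^ (1:ℝ) := Real.rpow_le_rpow_of_exponent_ge hs0 hs1.le hθ.le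
        _ = _ := Real.rpow_one _
    have t3 : T ^ (θ - 1) * (τ * d) ≤ b * (τ * d) := by
      rcases le_total R ‖x0 - z‖ with h | h
      · have : d = 0 := (hout x0 h).2
        rw [this]; simp
      · have hTB : T ≤ B := by
          have h1 : p ≤ |B0| := (hB0 x0 (by simpa [dist_eq_norm] using h)).trans (le_abs_self _)
          have h2 : τ * d ≤ τ * Y := mul_le_mul_of_nonneg_left (hY x0) hτ.le
          have h3 : s * p ≤ p := by nlinarith
          linarith
        refine mul_le_mul_of_nonneg_right ?_ (by positivity)
        exact Real.rpow_le_rpow hT0 hTB (by linarith)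
    have t4 : s * p - T = -(τ * d) := by rw [hTd]; ring
    rw [t4] at t1
    have t5 := mul_le_mul_of_nonneg_left t3 hθ0.le
    linarith
  have n2 : ‖fderiv ℝ φ x0‖ ^ θ ≤ T ^ θ := Real.rpow_le_rpow (norm_nonneg _) hT hθ0.le
  have n3 : (1/θ) * ‖fderiv ℝ φ x0‖ ^ θ ≤ s * ((1/θ) * p ^ θ) + b * (τ * d) := by
    calc (1/θ) * ‖fderiv ℝ φ x0‖ ^ θ ≤ (1/θ) * (s * p ^ θ + θ * (b * (τ * d))) := by
          gcongr; linarith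
      _ = _ := by field_simp
  have n4 := hφ.eq x0
  have n5 := hψ.eq x0
  rw [← hp] at n5
  set G := (1 / 2) * lap χ x0 - b * d with hGd
  have n6 : (1 - s) * (f x0 - lam) + τ * G ≤ 0 := by
    have : f x0 - lam ≤ s * (f x0 - lam) - τ * G := by
      calc f x0 - lam = -(1/2) * lap φ x0 + (1/θ) * ‖fderiv ℝ φ x0‖ ^ θ := n4.symm
        _ ≤ -(1/2) * (s * lap ψ x0 + τ * lap χ x0) + (s * ((1/θ) * p ^ θ) + b * (τ * d)) := by
            linarith
        _ = s * (-(1/2) * lap ψ x0 + (1/θ) * p ^ θ) - τ * G := by rw [hGd]; ring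
        _ = _ := by rw [n5]
    linarith
  have hfp := hf.pos x0
  have hs2 : 0 < 1 - s := by linarith
  rcases lt_or_ge ‖x0 - z‖ δ with hxd | hxd
  · have h1 := hδw x0 hxd
    have h2 : s * ψ y + τ * χ y - φ y ≤ s * ψ x0 + τ * χ x0 - φ x0 := hx0 y
    have h3 := hχ0 y
    have h4 : τ * χ x0 ≤ τ * X := mul_le_mul_of_nonneg_left (hX x0) hτ.le
    have h5 : 0 ≤ τ * χ y := by positivity
    have h6 := hψ.one x0
    have h7 : 0 ≤ (1 - s) * ψ x0 := by positivity
    linarith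
  · have hG1 := hG x0 hxd
    have hGnn : 0 ≤ G := (pp_nonneg _ _).trans hG1
    rcases le_total R' ‖x0 - z‖ with h | h
    · have h1 := hR' x0 h
      have h2 : 0 < (1 - s) * (f x0 - lam) := mul_pos hs2 (by linarith)
      have h3 : 0 ≤ τ * G := by positivity
      linarith
    · have hq : 1 ≤ quad (R ^ 2) z x0 := by
        unfold quad
        have := norm_nonneg (x0 - z)
        nlinarith
      have hG2 : 1 ≤ G := by
        refine le_trans ?_ hG1
        rw [pp_of_nonneg _ (by linarith)]
        exact one_le_pow₀ hq
      have h1 : τ ≤ τ * G := by nlinarith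
      have h2 : (1 - s) * lam ≤ (1 - s) * |lam| := mul_le_mul_of_nonneg_left (le_abs_self _) hs2.le
      have h3 : 0 < (1 - s) * f x0 := by positivity
      nlinarith

end Erg

open Filter MeasureTheory Topology

namespace Erg
variable {m : ℕ}

lemma fdata {α f₀ : ℝ} (hα : 0 < α) (hf₀ : 0 < f₀) {f : E m → ℝ} (hH0 : H0 f α f₀)
    (hH1 : H1 f α f₀) : ∃ L, FData f L f₀⁻¹ := by
  obtain ⟨L, hL, h⟩ := f_lip hα hf₀ hH0 hH1
  refine ⟨L, hH0.1.continuous, inv_pos.2 hf₀, f_pos hf₀ hH1, hL, h, ?_⟩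
  have h1 : Tendsto (fun y : E m => ‖y‖ ^ α) (cocompact (E m)) atTop :=
    (tendsto_rpow_atTop hα).comp (tendsto_norm_cocompact_atTop (E := E m))
  have h2 := (tendsto_atTop_add_const_right _ (1:ℝ) h1).const_mul_atTop (inv_pos.2 hf₀)
  exact tendsto_atTop_mono (fun y => (hH1 y).1) h2

lemma normalize {θ : ℝ} {f : E m → ℝ} {lam : ℝ} {φ : E m → ℝ} (h : IsSolution θ f lam φ)
    (hb : BddBelow (Set.range φ)) : ∃ a, Sol θ f lam (fun y => φ y + a) := by
  obtain ⟨b, hb⟩ := hb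
  refine ⟨1 - b, h.1.add contDiff_const, fun y => ?_, fun y => ?_⟩
  · have := hb (Set.mem_range_self y)
    linarith
  · rw [lap_add_const, fderiv_add_const, ← norm_grad]
    exact h.2 y

end Erg

theorem stmt17 (m : ℕ) (hm : 1 ≤ m) (θ : ℝ) (hθ1 : 1 < θ) (hθ2 : θ < 2)
    (α f₀ : ℝ) (hα : 0 < α) (hf₀ : 0 < f₀)
    (f : EuclideanSpace ℝ (Fin m) → ℝ) (hH0 : H0 f α f₀) (hH1 : H1 f α f₀)
    (lam₁ lam₂ : ℝ) (φ ψ : EuclideanSpace ℝ (Fin m) → ℝ)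
    (h₁ : IsSolution θ f lam₁ φ) (h₂ : IsSolution θ f lam₂ ψ)
    (hφ : BddBelow (Set.range φ)) (hψ : BddBelow (Set.range ψ)) :
    lam₁ = lam₂ ∧ ∃ C : ℝ, ∀ y, φ y = ψ y + C := by
  obtain ⟨L, hf⟩ := Erg.fdata hα hf₀ hH0 hH1
  obtain ⟨a, ha⟩ := Erg.normalize h₁ hφ
  obtain ⟨b, hb⟩ := Erg.normalize h₂ hψ
  have hl : lam₁ = lam₂ :=
    le_antisymm (Erg.lam_le hθ1 hθ2 hf hb ha) (Erg.lam_le hθ1 hθ2 hf ha hb)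
  subst hl
  refine ⟨rfl, φ 0 - ψ 0, fun y => ?_⟩
  have e1 := Erg.w_le hθ1 hθ2 hf ha hb y 0
  have e2 := Erg.w_le hθ1 hθ2 hf ha hb 0 y
  linarith
end

section
/- Let m ≥ 1 and θ > 1, and assume either (a) θ ≥ 2 and f : ℝ^m → ℝ is locally Lipschitz continuous and coercive, or (b) 1 < θ < 2 and f satisfies (H0) and (H1). If (λ, φ) is a solution of the ergodic problem (EP) with φ bounded from below on ℝ^m, then λ = λ*(f), where λ*(f) := sup{ μ ∈ ℝ : (EP)_μ admits a C² subsolution }. -/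
open Filter

open Topology in
/-- Second-order jet (gradient and Laplacian) of a function at a point. -/
def HasJet {m : ℕ} (u : EuclideanSpace ℝ (Fin m) → ℝ) (x p : EuclideanSpace ℝ (Fin m))
    (L : ℝ) : Prop :=
  ∃ (u1 : EuclideanSpace ℝ (Fin m) → (EuclideanSpace ℝ (Fin m) →L[ℝ] ℝ))
    (A : EuclideanSpace ℝ (Fin m) →L[ℝ] EuclideanSpace ℝ (Fin m) →L[ℝ] ℝ),
    (∀ᶠ y in 𝓝 x, HasFDerivAt u (u1 y) y) ∧ HasFDerivAt u1 A x ∧ u1 x = innerSL ℝ p ∧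
      L = ∑ i : Fin m, A (EuclideanSpace.single i 1) (EuclideanSpace.single i 1)

open Topology

namespace HasJet

variable {m : ℕ} {u v : EuclideanSpace ℝ (Fin m) → ℝ} {x p q : EuclideanSpace ℝ (Fin m)}
  {L M : ℝ}

theorem of_contDiff (hu : ContDiff ℝ 2 u) (x : EuclideanSpace ℝ (Fin m)) :
    HasJet u x (gradient u x) (lap u x) := by
  refine ⟨fderiv ℝ u, fderiv ℝ (fderiv ℝ u) x, ?_, ?_, ?_, ?_⟩
  · exact Eventually.of_forall fun y => (hu.differentiable (by norm_num) y).hasFDerivAt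
  · have : ContDiff ℝ 1 (fderiv ℝ u) := hu.fderiv_right (by norm_num)
    exact (this.differentiable (by norm_num) x).hasFDerivAt
  · ext y
    simp [gradient]
  · simp [lap, iteratedFDeriv_two_apply]

theorem add (hu : HasJet u x p L) (hv : HasJet v x q M) :
    HasJet (fun y => u y + v y) x (p + q) (L + M) := by
  obtain ⟨u1, A, h1, h2, h3, h4⟩ := hu
  obtain ⟨v1, B, k1, k2, k3, k4⟩ := hv
  refine ⟨fun y => u1 y + v1 y, A + B, ?_, h2.add k2, ?_, ?_⟩
  · filter_upwards [h1, k1] with y a b using a.add b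
  · simp [h3, k3]
  · simp [h4, k4, Finset.sum_add_distrib]

theorem smul (c : ℝ) (hu : HasJet u x p L) :
    HasJet (fun y => c * u y) x (c • p) (c * L) := by
  obtain ⟨u1, A, h1, h2, h3, h4⟩ := hu
  refine ⟨fun y => c • u1 y, c • A, ?_, h2.const_smul c, ?_, ?_⟩
  · filter_upwards [h1] with y a using a.const_mul c
  · simp [h3]
  · simp [h4, Finset.mul_sum]

theorem comp {g g1 : ℝ → ℝ} {g2 : ℝ} (hu : HasJet u x p L)
    (hg : ∀ᶠ t in 𝓝 (u x), HasDerivAt g (g1 t) t) (hg1 : HasDerivAt g1 g2 (u x)) :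
    HasJet (fun y => g (u y)) x (g1 (u x) • p) (g1 (u x) * L + g2 * ‖p‖ ^ 2) := by
  obtain ⟨u1, A, h1, h2, h3, h4⟩ := hu
  have hx : HasFDerivAt u (u1 x) x := h1.self_of_nhds
  have hc := hx.continuousAt
  refine ⟨fun y => g1 (u y) • u1 y, g1 (u x) • A + (g2 • u1 x).smulRight (u1 x), ?_, ?_, ?_, ?_⟩
  · filter_upwards [h1, hc.eventually hg] with y a b using b.comp_hasFDerivAt y a
  · exact (hg1.comp_hasFDerivAt x hx).smul h2
  · simp [h3]
  · simp [h4, h3, Finset.sum_add_distrib, Finset.mul_sum, EuclideanSpace.real_norm_sq_eq,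
      EuclideanSpace.inner_single_right]
    refine Finset.sum_congr rfl fun i _ => by ring

theorem normSq (x y0 : EuclideanSpace ℝ (Fin m)) :
    HasJet (fun y => ‖y - y0‖ ^ 2) x ((2 : ℝ) • (x - y0)) (2 * m) := by
  refine ⟨fun y => (2 : ℝ) • innerSL ℝ (y - y0), (2 : ℝ) • innerSL ℝ, ?_, ?_, ?_, ?_⟩
  · refine Eventually.of_forall fun y => ?_
    have := ((hasFDerivAt_id y).sub_const y0).norm_sq
    have e : (2 : ℝ) • innerSL ℝ (y - y0) = 2 • (innerSL ℝ (id y - y0)).comp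
        (ContinuousLinearMap.id ℝ (EuclideanSpace ℝ (Fin m))) := by
      ext z
      simp
    have this2 : HasFDerivAt (fun y => ‖y - y0‖ ^ 2) ((2 : ℝ) • innerSL ℝ (y - y0)) y := by
      rw [e]; exact this
    exact this2
  · exact (((innerSL ℝ).hasFDerivAt (x := x - y0)).comp x
      ((hasFDerivAt_id x).sub_const y0)).const_smul (2:ℝ)
  · simp
  · have h : ∀ i : Fin m, ((2 : ℝ) • innerSL ℝ (E := EuclideanSpace ℝ (Fin m)))
        (EuclideanSpace.single i 1) (EuclideanSpace.single i 1) = 2 := by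
      intro i
      have : inner ℝ (EuclideanSpace.single i (1:ℝ) : EuclideanSpace ℝ (Fin m))
        (EuclideanSpace.single i (1:ℝ)) = 1 := by simp
      change (2 : ℝ) * inner ℝ (EuclideanSpace.single i (1:ℝ) : EuclideanSpace ℝ (Fin m))
        (EuclideanSpace.single i (1:ℝ)) = 2
      rw [this]; norm_num
    refine Eq.trans ?_ (Finset.sum_congr rfl fun i _ => (h i).symm)
    simp [mul_comm]

theorem localMin (hu : HasJet u x p L) (hmin : IsLocalMin u x) : p = 0 ∧ 0 ≤ L := by
  obtain ⟨u1, A, h1, h2, h3, h4⟩ := hu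
  have hx : HasFDerivAt u (u1 x) x := h1.self_of_nhds
  have h0 := hmin.hasFDerivAt_eq_zero hx
  refine ⟨?_, ?_⟩
  · rw [h3] at h0
    have : innerSL ℝ p p = 0 := by rw [h0]; rfl
    simpa using this
  · rw [h4]
    refine Finset.sum_nonneg fun i _ => ?_
    set e : EuclideanSpace ℝ (Fin m) := EuclideanSpace.single i 1
    by_contra hneg
    push Not at hneg
    have hline : ∀ t : ℝ, HasDerivAt (fun t : ℝ => x + t • e) e t := fun t => by
      simpa using ((hasDerivAt_id t).smul_const e).const_add x
    have hcl : ContinuousAt (fun t : ℝ => x + t • e) 0 := (hline 0).continuousAt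
    have hx0 : (fun t : ℝ => x + t • e) 0 = x := by simp
    have hev : ∀ᶠ t in 𝓝 (0:ℝ), HasDerivAt (fun t : ℝ => u (x + t • e)) (u1 (x + t • e) e) t := by
      have := hcl.eventually (hx0.symm ▸ h1)
      filter_upwards [this] with t ht using ht.comp_hasDerivAt t (hline t)
    have hd : deriv (fun t : ℝ => u (x + t • e)) =ᶠ[𝓝 0] fun t => u1 (x + t • e) e := by
      filter_upwards [hev] with t ht using ht.deriv
    have hd2 : HasDerivAt (fun t : ℝ => u1 (x + t • e) e) (A e e) 0 := by
      have h2' : HasFDerivAt u1 A ((fun t : ℝ => x + t • e) 0) := by rw [hx0]; exact h2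
      have := h2'.comp_hasDerivAt (0:ℝ) (hline 0)
      have h5 := this.clm_apply (hasDerivAt_const (0:ℝ) e)
      simpa using h5
    have hdd : deriv (deriv (fun t : ℝ => u (x + t • e))) 0 = A e e := by
      rw [hd.deriv_eq, hd2.deriv]
    have hmax : IsLocalMax (fun t : ℝ => u (x + t • e)) 0 := by
      apply isLocalMax_of_deriv_deriv_neg
      · rw [hdd]; exact hneg
      · rw [hd.self_of_nhds]; simp [h0]
      · exact hev.self_of_nhds.continuousAt
    have hmin' : IsLocalMin (fun t : ℝ => u (x + t • e)) 0 := by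
      have := hcl.eventually (hx0.symm ▸ hmin : ∀ᶠ y in 𝓝 ((fun t : ℝ => x + t • e) 0), u x ≤ u y)
      filter_upwards [this] with t ht
      simpa using ht
    have hconst : (fun t : ℝ => u (x + t • e)) =ᶠ[𝓝 0] fun _ => u x := by
      filter_upwards [hmax, hmin'] with t a b
      simp at a b
      linarith
    have : A e e = 0 := by
      rw [← hdd, hconst.deriv.deriv_eq]
      simp
    linarith

/-- Touching: if `v - u` has a local minimum, gradients agree and Laplacians are ordered. -/
theorem touch (hu : HasJet u x p L) (hv : HasJet v x q M)
    (hmin : IsLocalMin (fun y => v y + (-1) * u y) x) : q = p ∧ L ≤ M := by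
  obtain ⟨h1, h2⟩ := (hv.add (hu.smul (-1))).localMin hmin
  constructor
  · have : q - p = 0 := by rw [← h1]; module
    exact sub_eq_zero.mp this
  · linarith

end HasJet

section aux

variable {m : ℕ} {θ : ℝ} {f : EuclideanSpace ℝ (Fin m) → ℝ}

theorem touch_sol {lam : ℝ} {φ q : EuclideanSpace ℝ (Fin m) → ℝ} (hsol : IsSolution θ f lam φ)
    {z p : EuclideanSpace ℝ (Fin m)} {L : ℝ} (hq : HasJet q z p L)
    (hmin : IsLocalMin (fun y => φ y + (-1) * q y) z) :
    f z - lam ≤ -(1/2) * L + (1/θ) * ‖p‖ ^ θ := by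
  obtain ⟨h1, h2⟩ := hq.touch (HasJet.of_contDiff hsol.1 z) hmin
  have h3 := hsol.2 z
  rw [h1] at h3
  linarith

theorem touch_sub {mu : ℝ} {ψ q : EuclideanSpace ℝ (Fin m) → ℝ} (hsub : IsSubsolution θ f mu ψ)
    {z p : EuclideanSpace ℝ (Fin m)} {L : ℝ} (hq : HasJet q z p L)
    (hmin : IsLocalMin (fun y => q y + (-1) * ψ y) z) :
    -(1/2) * L + (1/θ) * ‖p‖ ^ θ ≤ f z - mu := by
  obtain ⟨h1, h2⟩ := (HasJet.of_contDiff hsub.1 z).touch hq hmin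
  have h3 := hsub.2 z
  rw [← h1] at h3
  linarith

theorem ham_convex (hθ : 1 < θ) {a : ℝ} (ha : 0 ≤ a) (ha1 : a ≤ 1)
    (p q : EuclideanSpace ℝ (Fin m)) (L M : ℝ) :
    -(1/2) * (a * L + (1 - a) * M) + (1/θ) * ‖a • p + (1 - a) • q‖ ^ θ
      ≤ a * (-(1/2) * L + (1/θ) * ‖p‖ ^ θ) + (1 - a) * (-(1/2) * M + (1/θ) * ‖q‖ ^ θ) := by
  have h1 : ‖a • p + (1 - a) • q‖ ≤ a * ‖p‖ + (1 - a) * ‖q‖ := by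
    refine (norm_add_le _ _).trans ?_
    rw [norm_smul, norm_smul, Real.norm_of_nonneg ha, Real.norm_of_nonneg (by linarith)]
  have h2 : ‖a • p + (1 - a) • q‖ ^ θ ≤ (a * ‖p‖ + (1 - a) * ‖q‖) ^ θ :=
    Real.rpow_le_rpow (norm_nonneg _) h1 (by linarith)
  have h3 := (convexOn_rpow hθ.le).2 (norm_nonneg p) (norm_nonneg q) ha
    (by linarith : 0 ≤ 1 - a) (by ring)
  simp only [smul_eq_mul] at h3
  have h4 : 0 < 1 / θ := by positivity
  nlinarith [mul_le_mul_of_nonneg_left (h2.trans h3) h4.le]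

theorem jet_norm {z : EuclideanSpace ℝ (Fin m)} (hz : z ≠ 0) :
    HasJet (fun y => ‖y‖) z (‖z‖⁻¹ • z) ((m - 1) / ‖z‖) := by
  have hr : 0 < ‖z‖ := norm_pos_iff.mpr hz
  have h0 := HasJet.normSq z (0 : EuclideanSpace ℝ (Fin m))
  simp only [sub_zero] at h0
  have hpos : 0 < ‖z‖ ^ 2 := by positivity
  have hd : ∀ t : ℝ, 0 < t → HasDerivAt Real.sqrt (1 / (2 * √t)) t := fun t ht =>
    Real.hasDerivAt_sqrt ht.ne'
  have hd2 : HasDerivAt (fun t => 1 / (2 * √t)) (-(2 * (1 / (2 * √(‖z‖^2)))) / (2 * √(‖z‖^2)) ^ 2)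
      (‖z‖ ^ 2) := by
    have := ((hd _ hpos).const_mul 2).inv (by positivity)
    simpa [Pi.inv_def, one_div] using this
  have := h0.comp (g := Real.sqrt) (g1 := fun t => 1 / (2 * √t))
    ((eventually_gt_nhds hpos).mono hd) hd2
  simp only [Real.sqrt_sq (norm_nonneg _)] at this
  convert this using 1
  · rw [smul_smul]; congr 1; field_simp
  · rw [norm_smul]; simp; field_simp; ring

end aux

section caseA

variable {m : ℕ} {θ : ℝ} {f : EuclideanSpace ℝ (Fin m) → ℝ}

theorem jet_log (z : EuclideanSpace ℝ (Fin m)) :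
    ∃ p L, HasJet (fun y => Real.log (1 + ‖y‖ ^ 2)) z p L ∧ ‖p‖ ≤ 1 ∧ L ≤ 2 * m := by
  have h0 := HasJet.normSq z (0 : EuclideanSpace ℝ (Fin m))
  simp only [sub_zero] at h0
  have hd : ∀ t : ℝ, -1 < t → HasDerivAt (fun t => Real.log (1 + t)) ((1 + t)⁻¹) t := fun t ht => by
    have := ((hasDerivAt_id t).const_add 1).log (by simp; linarith)
    simpa using this
  have hp : (0:ℝ) < 1 + ‖z‖ ^ 2 := by positivity
  have hd2 : HasDerivAt (fun t : ℝ => (1 + t)⁻¹) (-1 / (1 + ‖z‖ ^ 2) ^ 2) (‖z‖ ^ 2) := by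
    have := ((hasDerivAt_id (‖z‖^2)).const_add 1).inv (by simp; positivity)
    simpa [Pi.inv_def] using this
  have := h0.comp (g := fun t => Real.log (1 + t)) (g1 := fun t => (1 + t)⁻¹)
    ((eventually_gt_nhds (by nlinarith [sq_nonneg ‖z‖] : -1 < ‖z‖ ^ 2)).mono hd) hd2
  refine ⟨_, _, this, ?_, ?_⟩
  · rw [norm_smul, norm_smul, Real.norm_of_nonneg (by positivity), Real.norm_of_nonneg (by norm_num),
      inv_mul_le_iff₀ hp]
    nlinarith [sq_nonneg (‖z‖ - 1)]
  · have h1 : (1 + ‖z‖ ^ 2)⁻¹ ≤ 1 := inv_le_one_of_one_le₀ (by nlinarith [sq_nonneg ‖z‖])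
    have h2 : -1 / (1 + ‖z‖ ^ 2) ^ 2 * ‖(2:ℝ) • z‖ ^ 2 ≤ 0 :=
      mul_nonpos_of_nonpos_of_nonneg (div_nonpos_of_nonpos_of_nonneg (by norm_num) (by positivity))
        (by positivity)
    have h3 : (1 + ‖z‖ ^ 2)⁻¹ * (2 * (m : ℝ)) ≤ 1 * (2 * (m : ℝ)) :=
      mul_le_mul_of_nonneg_right h1 (by positivity)
    linarith

/-- the logistic weight -/
noncomputable def sg (κ K t : ℝ) : ℝ := 1 - (1 + Real.exp (κ * (K - t)))⁻¹

/-- the smooth truncation -/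
noncomputable def tr (κ K t : ℝ) : ℝ := K - κ⁻¹ * Real.log (1 + Real.exp (κ * (K - t)))

theorem tr_deriv {κ : ℝ} (hκ : 0 < κ) (K t : ℝ) : HasDerivAt (tr κ K) (sg κ K t) t := by
  have h1 : HasDerivAt (fun t => κ * (K - t)) (-κ) t := by
    simpa using ((hasDerivAt_id t).const_sub K).const_mul κ
  have hp : 0 < 1 + Real.exp (κ * (K - t)) := by positivity
  have h2 := (((h1.exp.const_add 1).log hp.ne').const_mul κ⁻¹).const_sub K
  refine HasDerivAt.congr_deriv (f := tr κ K) h2 ?_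
  unfold sg
  field_simp
  ring

theorem sg_deriv (κ K t : ℝ) :
    HasDerivAt (sg κ K) (-(κ * (sg κ K t * (1 - sg κ K t)))) t := by
  have h1 : HasDerivAt (fun t => κ * (K - t)) (-κ) t := by
    simpa using ((hasDerivAt_id t).const_sub K).const_mul κ
  have hp : 0 < 1 + Real.exp (κ * (K - t)) := by positivity
  have h2 := ((h1.exp.const_add 1).inv hp.ne').const_sub 1
  have h3 : HasDerivAt (sg κ K) (-(-(Real.exp (κ * (K - t)) * -κ) / (1 + Real.exp (κ * (K - t))) ^ 2)) t := h2
  refine h3.congr_deriv ?_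
  unfold sg
  field_simp
  ring

theorem sg_bounds (κ K t : ℝ) : 0 < sg κ K t ∧ sg κ K t < 1 := by
  have he := Real.exp_pos (κ * (K - t))
  unfold sg
  constructor
  · have : (1 + Real.exp (κ * (K - t)))⁻¹ < 1 := inv_lt_one_of_one_lt₀ (by linarith)
    linarith
  · have : 0 < (1 + Real.exp (κ * (K - t)))⁻¹ := by positivity
    linarith

theorem tr_le {κ : ℝ} (hκ : 0 < κ) (K t : ℝ) : tr κ K t ≤ K := by
  have he := Real.exp_pos (κ * (K - t))
  have : 0 ≤ κ⁻¹ * Real.log (1 + Real.exp (κ * (K - t))) :=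
    mul_nonneg (by positivity) (Real.log_nonneg (by linarith))
  unfold tr; linarith

/-- scalar inequality for the truncation -/
theorem trunc_ineq (hθ : 2 ≤ θ) {κ σ s A Lp : ℝ} (hκ : 0 < κ) (hκ2 : κ ≤ 2 / θ) (hs : 0 ≤ s)
    (h0 : 0 < σ) (h1 : σ < 1) (hsub : -(1/2) * Lp + (1/θ) * s ^ θ ≤ A) :
    -(1/2) * (σ * Lp + -(κ * (σ * (1 - σ))) * s ^ 2) + (1/θ) * (σ * s) ^ θ ≤ σ * A + κ := by
  have hθ0 : 0 < θ := by linarith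
  rw [Real.mul_rpow h0.le hs]
  have hT : 0 ≤ s ^ θ := by positivity
  have hσ : σ ^ θ ≤ σ ^ 2 := by
    rw [← Real.rpow_natCast σ 2]
    exact Real.rpow_le_rpow_of_exponent_ge h0 h1.le (by exact_mod_cast hθ)
  have hsq : s ^ 2 ≤ 1 + s ^ θ := by
    by_cases h : s ≤ 1
    · nlinarith
    · push Not at h
      have : s ^ 2 ≤ s ^ θ := by
        rw [← Real.rpow_natCast s 2]
        exact Real.rpow_le_rpow_of_exponent_le h.le (by exact_mod_cast hθ)
      linarith
  have hκ3 : κ / 2 ≤ 1 / θ := by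
    have : 1 / θ = (2 / θ) / 2 := by ring
    linarith
  set T := s ^ θ
  have hw : 0 ≤ σ * (1 - σ) := mul_nonneg h0.le (by linarith)
  have hw1 : σ * (1 - σ) ≤ 1 := by nlinarith
  have e1 : κ / 2 * (σ * (1 - σ)) * s ^ 2 ≤ κ / 2 * (σ * (1 - σ)) * (1 + T) :=
    mul_le_mul_of_nonneg_left hsq (by positivity)
  have e2 : κ / 2 * (σ * (1 - σ) * T) ≤ 1 / θ * (σ * (1 - σ) * T) :=
    mul_le_mul_of_nonneg_right hκ3 (by positivity)
  have e3 : (1 / θ) * (σ ^ θ * T) ≤ (1 / θ) * (σ ^ 2 * T) := by gcongr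
  have e4 := mul_le_mul_of_nonneg_left hsub h0.le
  have e5 : κ / 2 * (σ * (1 - σ)) ≤ κ / 2 * 1 := mul_le_mul_of_nonneg_left hw1 (by positivity)
  nlinarith

theorem caseA (hθ : 2 ≤ θ) (hf : LocallyLipschitz f) (hco : Coercive f) {lam mu : ℝ}
    {φ ψ : EuclideanSpace ℝ (Fin m) → ℝ} (hsol : IsSolution θ f lam φ)
    (hφ : BddBelow (Set.range φ)) (hsub : IsSubsolution θ f mu ψ) : mu ≤ lam := by
  by_contra hlt
  push Not at hlt
  have hθ0 : 0 < θ := by linarith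
  obtain ⟨b, hb⟩ := hφ
  replace hb : ∀ y, b ≤ φ y := fun y => hb ⟨y, rfl⟩
  -- lower bound for f
  obtain ⟨x0, hx0⟩ := hf.continuous.exists_forall_le hco
  -- bound for ψ on the sublevel set
  have hcomp : ∃ S : Set (EuclideanSpace ℝ (Fin m)), IsCompact S ∧ ∀ y, f y < mu → y ∈ S := by
    have := hco.eventually (eventually_ge_atTop mu)
    obtain ⟨S, hS, hS2⟩ := mem_cocompact.mp this
    refine ⟨S, hS, fun y hy => ?_⟩
    by_contra hn
    have : mu ≤ f y := hS2 hn
    linarith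
  obtain ⟨S, hS, hS2⟩ := hcomp
  obtain ⟨M, hM⟩ := hS.bddAbove_image hsub.1.continuous.continuousOn
  replace hM : ∀ y, f y < mu → ψ y ≤ M := fun y hy => hM ⟨y, hS2 y hy, rfl⟩
  obtain ⟨κ, hκ, hκ1, hκ2⟩ : ∃ κ : ℝ, 0 < κ ∧ κ ≤ (mu - lam) / 4 ∧ κ ≤ 2 / θ :=
    ⟨min ((mu - lam) / 4) (2 / θ), lt_min (by linarith) (by positivity), min_le_left _ _,
      min_le_right _ _⟩
  set D : ℝ := |mu - f x0| with hD
  set K : ℝ := M + D / (κ * κ) with hK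
  set C : ℝ := |m + 1 + mu - f x0| with hC
  obtain ⟨ε, hε, hε1, hε2⟩ : ∃ ε : ℝ, 0 < ε ∧ ε < 1 ∧ ε * C < (mu - lam) / 4 := by
    refine ⟨min (1/2) ((mu - lam) / 4 / (2 * (C + 1))), ?_, ?_, ?_⟩
    · have : 0 ≤ C := abs_nonneg _
      exact lt_min (by norm_num) (by apply div_pos <;> linarith)
    · exact (min_le_left _ _).trans_lt (by norm_num)
    · have hC0 : 0 ≤ C := abs_nonneg _
      have h1 := min_le_right (1/2) ((mu - lam) / 4 / (2 * (C + 1)))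
      calc _ ≤ ((mu - lam) / 4 / (2 * (C + 1))) * C := mul_le_mul_of_nonneg_right h1 hC0
        _ < _ := by
          rw [div_mul_eq_mul_div, div_lt_iff₀ (by positivity)]
          nlinarith
  -- the truncated subsolution is good
  have htr : ∀ z, ∃ p L, HasJet (fun y => tr κ K (ψ y)) z p L ∧
      -(1/2) * L + (1/θ) * ‖p‖ ^ θ ≤ f z - mu + 2 * κ := by
    intro z
    have hj := (HasJet.of_contDiff hsub.1 z).comp (g := tr κ K) (g1 := sg κ K)
      (Eventually.of_forall (tr_deriv hκ K)) (sg_deriv κ K (ψ z))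
    refine ⟨_, _, hj, ?_⟩
    obtain ⟨h0, h1⟩ := sg_bounds κ K (ψ z)
    have := trunc_ineq hθ hκ hκ2 (norm_nonneg _) h0 h1 (hsub.2 z)
    rw [norm_smul, Real.norm_of_nonneg h0.le]
    refine this.trans ?_
    have : (1 - sg κ K (ψ z)) * (mu - f z) ≤ κ := by
      by_cases hfz : f z < mu
      · have hψ := hM z hfz
        have e : 1 - sg κ K (ψ z) = (1 + Real.exp (κ * (K - ψ z)))⁻¹ := by unfold sg; ring
        rw [e, inv_mul_le_iff₀ (by positivity)]
        have h3 : κ * (K - ψ z) + 1 ≤ Real.exp (κ * (K - ψ z)) := Real.add_one_le_exp _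
        have h4 : D / κ ≤ κ * (K - ψ z) := by
          have : D / κ = κ * (D / (κ * κ)) := by field_simp
          rw [this]
          apply mul_le_mul_of_nonneg_left _ hκ.le
          linarith
        have h5 : mu - f z ≤ D := by
          have := le_abs_self (mu - f x0)
          have := hx0 z
          linarith
        have h6 : D = (D / κ) * κ := by field_simp
        nlinarith
      · push Not at hfz
        have : (1 - sg κ K (ψ z)) * (mu - f z) ≤ 0 :=
          mul_nonpos_of_nonneg_of_nonpos (by linarith) (by linarith)
        linarith
    nlinarith
  -- the minimum
  let w : EuclideanSpace ℝ (Fin m) → ℝ := fun y => φ y + (-1) *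
    ((1 - ε) * tr κ K (ψ y) + (1 - (1 - ε)) * ((-1) * Real.log (1 + ‖y‖ ^ 2)))
  have hwc : Continuous w := by
    have h1 : Continuous (tr κ K) :=
      continuous_iff_continuousAt.mpr fun t => (tr_deriv hκ K t).continuousAt
    have h2 := hsol.1.continuous
    have h3 := h1.comp hsub.1.continuous
    have h4 : Continuous fun y : EuclideanSpace ℝ (Fin m) => Real.log (1 + ‖y‖ ^ 2) := by
      refine Continuous.log (by fun_prop) fun y => by positivity
    simp only [Function.comp_def] at h3
    fun_prop
  have hwt : Tendsto w (cocompact _) atTop := by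
    have h1 : Tendsto (fun y : EuclideanSpace ℝ (Fin m) => Real.log (1 + ‖y‖ ^ 2))
        (cocompact _) atTop := by
      refine Real.tendsto_log_atTop.comp (tendsto_atTop_add_const_left _ _ ?_)
      exact (tendsto_pow_atTop (by norm_num)).comp (tendsto_norm_cocompact_atTop)
    have h2 := tendsto_atTop_add_const_left _ (b - (1 - ε) * K) (h1.const_mul_atTop hε)
    refine tendsto_atTop_mono (fun y => ?_) h2
    have h3 := mul_le_mul_of_nonneg_left (tr_le hκ K (ψ y)) (by linarith : 0 ≤ 1 - ε)
    have := hb y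
    simp only [w]
    linarith
  obtain ⟨z, hz⟩ := hwc.exists_forall_le hwt
  obtain ⟨p, L, hj, hj2⟩ := htr z
  obtain ⟨p', L', hl, hl1, hl2⟩ := jet_log z
  have hmain := touch_sol hsol ((hj.smul (1 - ε)).add ((hl.smul (-1)).smul (1 - (1 - ε))))
    (Eventually.of_forall hz)
  have hcv := ham_convex (by linarith : 1 < θ) (by linarith : 0 ≤ 1 - ε) (by linarith)
    p ((-1 : ℝ) • p') L (-1 * L')
  have hn : ‖(-1 : ℝ) • p'‖ ^ θ ≤ 1 := by
    rw [neg_one_smul, norm_neg]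
    exact Real.rpow_le_one (norm_nonneg _) hl1 hθ0.le
  have h1θ : (1/θ) * ‖(-1 : ℝ) • p'‖ ^ θ ≤ 1 := by
    have : 1 / θ ≤ 1 := by rw [div_le_one hθ0]; linarith
    have h0 : 0 ≤ 1 / θ := by positivity
    nlinarith [Real.rpow_nonneg (norm_nonneg ((-1 : ℝ) • p')) θ]
  have h2 := mul_le_mul_of_nonneg_left hj2 (by linarith : 0 ≤ 1 - ε)
  have h3 : (1 - (1 - ε)) * (-(1/2) * (-1 * L') + (1/θ) * ‖(-1 : ℝ) • p'‖ ^ θ) ≤ ε * (m + 1) := by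
    have : (1 - (1 - ε)) = ε := by ring
    rw [this]
    apply mul_le_mul_of_nonneg_left _ hε.le
    linarith
  have h4 : ε * (m + 1 + mu - f z) ≤ ε * C := by
    apply mul_le_mul_of_nonneg_left _ hε.le
    have := le_abs_self (m + 1 + mu - f x0)
    have := hx0 z
    linarith
  have h5 : 0 ≤ ε * κ := by positivity
  nlinarith

end caseA

section caseB

variable {m : ℕ} {θ : ℝ} {f : EuclideanSpace ℝ (Fin m) → ℝ}

theorem young_const (hθ : 1 < θ) (m : ℕ) : ∃ C : ℝ, 0 ≤ C ∧ ∀ z : ℝ, 0 ≤ z →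
    m * z / 2 ≤ z ^ θ / (2 * θ) + C := by
  have hθ0 : 0 < θ := by linarith
  have hθ1 : 0 < θ - 1 := by linarith
  set Z : ℝ := (θ * m) ^ (1 / (θ - 1)) with hZ
  have hZ0 : 0 ≤ Z := by positivity
  refine ⟨m * Z / 2, by positivity, fun z hz => ?_⟩
  have hzp : 0 ≤ z ^ θ / (2 * θ) := by positivity
  by_cases h : z ≤ Z
  · have : (m : ℝ) * z ≤ m * Z := by gcongr
    linarith
  · push Not at h
    have hzpos : 0 < z := by linarith
    have h1 : Z ^ (θ - 1) ≤ z ^ (θ - 1) := Real.rpow_le_rpow hZ0 h.le hθ1.le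
    have h2 : Z ^ (θ - 1) = θ * m := by
      rw [hZ, ← Real.rpow_mul (by positivity), one_div, inv_mul_cancel₀ hθ1.ne', Real.rpow_one]
    have h3 : z ^ θ = z * z ^ (θ - 1) := by
      rw [← Real.rpow_one_add' hz (by linarith)]; congr 1; ring
    have h4 : m * z / 2 ≤ z ^ θ / (2 * θ) := by
      rw [h3, div_le_div_iff₀ (by norm_num) (by positivity)]
      rw [h2] at h1
      nlinarith [mul_le_mul_of_nonneg_left h1 hz]
    have : 0 ≤ (m : ℝ) * Z / 2 := by positivity
    linarith

theorem barrier_const (hθ : 1 < θ) (hθ2 : θ < 2) : ∃ a B : ℝ, 0 < a ∧ 0 < B ∧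
    ∀ d : ℝ, 0 < d → (a * (a + 1) * B * d ^ (-a - 2)) / 2 ≤ (a * B * d ^ (-a - 1)) ^ θ / (2 * θ) := by
  have hθ0 : 0 < θ := by linarith
  have hθ1 : 0 < θ - 1 := by linarith
  obtain ⟨a, ha, ha2⟩ : ∃ a : ℝ, 0 < a ∧ a * (θ - 1) = 2 - θ :=
    ⟨(2 - θ) / (θ - 1), div_pos (by linarith) hθ1, by field_simp⟩
  set Y : ℝ := (θ * (a + 1)) ^ (1 / (θ - 1)) with hY
  have hY0 : 0 < Y := by positivity
  refine ⟨a, Y / a, ha, by positivity, fun d hd => ?_⟩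
  have e1 : a * (Y / a) = Y := by field_simp
  have e2 : (Y * d ^ (-a - 1)) ^ θ = Y ^ θ * d ^ (-a - 2) := by
    rw [Real.mul_rpow hY0.le (by positivity), ← Real.rpow_mul hd.le]
    congr 2
    linarith
  have e3 : Y ^ θ = Y * (θ * (a + 1)) := by
    have h2 : Y ^ (θ - 1) = θ * (a + 1) := by
      rw [hY, ← Real.rpow_mul (by positivity), one_div, inv_mul_cancel₀ hθ1.ne', Real.rpow_one]
    rw [← h2, ← Real.rpow_one_add' hY0.le (by linarith)]
    congr 1; ring
  rw [e1, e2, e3]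
  apply le_of_eq
  field_simp

set_option maxHeartbeats 1000000 in
theorem sub_growth (hθ : 1 < θ) (hθ2 : θ < 2) {α f₀ mu : ℝ} (hα : 0 < α) (hf₀ : 0 < f₀)
    (hf : ∀ y, f y ≤ f₀ * (‖y‖ ^ α + 1)) {ψ : EuclideanSpace ℝ (Fin m) → ℝ}
    (hsub : IsSubsolution θ f mu ψ) :
    ∃ C : ℝ, 0 < C ∧ ∀ y, ψ y ≤ C * (1 + ‖y‖ ^ (1 + α / θ)) := by
  have hθ0 : 0 < θ := by linarith
  obtain ⟨Cy, hCy, hy⟩ := young_const hθ m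
  obtain ⟨a, B, ha, hB, hbar⟩ := barrier_const hθ hθ2
  obtain ⟨M1, hM1⟩ := (isCompact_closedBall (0 : EuclideanSpace ℝ (Fin m)) 1).bddAbove_image
    hsub.1.continuous.continuousOn
  replace hM1 : ∀ y, ‖y‖ ≤ 1 → ψ y ≤ M1 := fun y hy => hM1 ⟨y, by simpa using hy, rfl⟩
  set Q : ℝ := 2 * θ * (2 * f₀ + |mu| + Cy + 1) with hQ
  have hQ0 : 0 < Q := by positivity
  -- key pointwise bound
  have key : ∀ x : EuclideanSpace ℝ (Fin m), 1 ≤ ‖x‖ →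
      ψ x ≤ M1 + (Q ^ (1 / θ) * (2 * ‖x‖) ^ (α / θ)) * ‖x‖ + B * ‖x‖ ^ (-a) := by
    intro x hx
    set R : ℝ := 2 * ‖x‖ with hR
    set P : ℝ := Q ^ (1 / θ) * R ^ (α / θ) with hP
    have hR1 : 1 ≤ R := by linarith
    have hR0 : 0 < R := by linarith
    have hP0 : 0 ≤ P := by positivity
    have hPθ : P ^ θ = Q * R ^ α := by
      rw [hP, Real.mul_rpow (by positivity) (by positivity), ← Real.rpow_mul hQ0.le,
        ← Real.rpow_mul hR0.le]
      congr 2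
      · rw [one_div, inv_mul_cancel₀ hθ0.ne', Real.rpow_one]
      · field_simp
    by_contra hcon
    push Not at hcon
    obtain ⟨M2, hM2⟩ := (isCompact_closedBall (0 : EuclideanSpace ℝ (Fin m)) R).bddAbove_image
      hsub.1.continuous.continuousOn
    replace hM2 : ∀ y, ‖y‖ ≤ R → ψ y ≤ M2 := fun y hy => hM2 ⟨y, by simpa using hy, rfl⟩
    obtain ⟨d, hd0, hdx, hdM⟩ : ∃ d : ℝ, 0 < d ∧ d ≤ ‖x‖ ∧ M2 - M1 ≤ B * d ^ (-a) := by
      set T : ℝ := (|M2 - M1| + 1) / B with hT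
      have hT0 : 0 < T := by positivity
      have hT1 : 0 < T ^ (-(1 / a)) := by positivity
      refine ⟨min ‖x‖ (T ^ (-(1 / a))), lt_min (by linarith) hT1, min_le_left _ _, ?_⟩
      have h1 : (T ^ (-(1 / a))) ^ (-a) ≤ (min ‖x‖ (T ^ (-(1 / a)))) ^ (-a) :=
        Real.rpow_le_rpow_of_nonpos (lt_min (by linarith) hT1) (min_le_right _ _) (by linarith)
      have h2 : (T ^ (-(1 / a))) ^ (-a) = T := by
        rw [← Real.rpow_mul hT0.le]
        have : -(1 / a) * -a = 1 := by field_simp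
        rw [this, Real.rpow_one]
      rw [h2] at h1
      have h3 := mul_le_mul_of_nonneg_left h1 hB.le
      have h4 : B * T = |M2 - M1| + 1 := by rw [hT]; field_simp
      have := le_abs_self (M2 - M1)
      linarith
    let g : ℝ → ℝ := fun r => P * r + B * (R - r) ^ (-a)
    let S : Set (EuclideanSpace ℝ (Fin m)) := {y | 1 ≤ ‖y‖ ∧ ‖y‖ ≤ R - d}
    have hS : IsCompact S := by
      refine (isCompact_closedBall (0 : EuclideanSpace ℝ (Fin m)) R).of_isClosed_subset ?_ ?_
      · exact (isClosed_le continuous_const continuous_norm).inter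
          (isClosed_le continuous_norm continuous_const)
      · intro y hy
        have := hy.2
        simp; linarith
    have hxS : x ∈ S := ⟨hx, by linarith⟩
    have hcont : ContinuousOn (fun y => g ‖y‖ + (-1) * ψ y) S := by
      have h1 : ContinuousOn (fun y : EuclideanSpace ℝ (Fin m) => (R - ‖y‖) ^ (-a)) S := by
        refine ContinuousOn.rpow_const (by fun_prop) fun y hy => Or.inl ?_
        have := hy.2
        have : 0 < R - ‖y‖ := by linarith
        exact this.ne'
      have h2 := hsub.1.continuous
      simp only [g]
      fun_prop
    obtain ⟨z, hzS, hz⟩ := hS.exists_isMinOn ⟨x, hxS⟩ hcont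
    have hzx : g ‖z‖ + (-1) * ψ z ≤ g ‖x‖ + (-1) * ψ x := hz hxS
    have hRx : R - ‖x‖ = ‖x‖ := by rw [hR]; ring
    have hval : g ‖z‖ + (-1) * ψ z < -M1 := by
      have : g ‖x‖ = P * ‖x‖ + B * ‖x‖ ^ (-a) := by simp only [g, hRx]
      linarith
    have hz1 : 1 < ‖z‖ := by
      refine lt_of_le_of_ne hzS.1 fun h => ?_
      have h1 := hM1 z h.ge
      have h2 : 0 ≤ g ‖z‖ := by
        have : 0 ≤ R - ‖z‖ := by have := hzS.2; linarith
        simp only [g]; positivity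
      linarith
    have hz2 : ‖z‖ < R - d := by
      refine lt_of_le_of_ne hzS.2 fun h => ?_
      have h1 := hM2 z (by linarith)
      have h2 : M2 - M1 ≤ g ‖z‖ := by
        have e : R - ‖z‖ = d := by linarith
        have : 0 ≤ P * ‖z‖ := by positivity
        simp only [g]; rw [e]; linarith
      linarith
    have hloc : IsLocalMin (fun y => g ‖y‖ + (-1) * ψ y) z := by
      refine hz.isLocalMin ?_
      have h1 : ∀ᶠ y in 𝓝 z, 1 < ‖y‖ := (continuous_norm.continuousAt).eventually_const_lt hz1
      have h2 : ∀ᶠ y in 𝓝 z, ‖y‖ < R - d := (continuous_norm.continuousAt).eventually_lt_const hz2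
      filter_upwards [h1, h2] with y b c using ⟨b.le, c.le⟩
    have hz0 : z ≠ 0 := by
      rintro rfl
      simp at hz1
      linarith
    have hdz : 0 < R - ‖z‖ := by linarith
    let g1 : ℝ → ℝ := fun r => P + a * B * (R - r) ^ (-a - 1)
    let g2 : ℝ := a * (a + 1) * B * (R - ‖z‖) ^ (-a - 2)
    have hg : ∀ r : ℝ, r < R → HasDerivAt g (g1 r) r := by
      intro r hr
      have h1 := ((hasDerivAt_id r).const_sub R).rpow_const (p := -a) (Or.inl (by simp; linarith))
      have h2 := ((hasDerivAt_id r).const_mul P).add (h1.const_mul B)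
      refine HasDerivAt.congr_deriv (f := g) h2 ?_
      simp [g1]
      ring
    have hg1 : HasDerivAt g1 g2 ‖z‖ := by
      have h1 := ((hasDerivAt_id ‖z‖).const_sub R).rpow_const (p := -a - 1)
        (Or.inl (by simp; linarith))
      have h2 := (h1.const_mul (a * B)).const_add P
      refine HasDerivAt.congr_deriv (f := g1) h2 ?_
      have e : -a - 1 - 1 = -a - 2 := by ring
      simp [g2, e]
      ring
    have hjet := (jet_norm hz0).comp (g := g) (g1 := g1)
      ((eventually_lt_nhds (by linarith : ‖z‖ < R)).mono hg) hg1
    have hmain := touch_sub hsub hjet hloc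
    have hzn : ‖(‖z‖⁻¹ • z)‖ = 1 := by
      rw [norm_smul, norm_inv, norm_norm, inv_mul_cancel₀ (by positivity)]
    set X : ℝ := a * B * (R - ‖z‖) ^ (-a - 1) with hX
    have hX0 : 0 ≤ X := by positivity
    have hg1z : g1 ‖z‖ = P + X := rfl
    rw [norm_smul (g1 ‖z‖), hzn, hg1z, Real.norm_of_nonneg (by positivity)] at hmain
    have hsum : P ^ θ + X ^ θ ≤ (P + X) ^ θ := Real.add_rpow_le_rpow_add hP0 hX0 hθ.le
    have hb := hbar _ hdz
    have hyy := hy (P + X) (by positivity)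
    have hlap : (P + X) * ((m - 1) / ‖z‖) ≤ m * (P + X) := by
      rw [mul_comm (m : ℝ)]
      apply mul_le_mul_of_nonneg_left _ (by positivity)
      rw [div_le_iff₀ (by linarith)]
      have : (0:ℝ) ≤ m := by positivity
      nlinarith
    have hfz := hf z
    have hzα : ‖z‖ ^ α ≤ R ^ α := Real.rpow_le_rpow (norm_nonneg _) (by linarith) hα.le
    have hRα : 1 ≤ R ^ α := Real.one_le_rpow hR1 hα.le
    have hfz2 : f₀ * (‖z‖ ^ α + 1) ≤ f₀ * (2 * R ^ α) := by
      apply mul_le_mul_of_nonneg_left _ hf₀.le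
      linarith
    have hPd : P ^ θ / (2 * θ) = (2 * f₀ + |mu| + Cy + 1) * R ^ α := by
      rw [hPθ, hQ]; field_simp
    have hlow : 2 * f₀ * R ^ α + |mu| + Cy + 1 ≤ P ^ θ / (2 * θ) := by
      rw [hPd]
      have h1 : (|mu| + Cy + 1) * 1 ≤ (|mu| + Cy + 1) * R ^ α :=
        mul_le_mul_of_nonneg_left hRα (by positivity)
      linarith
    have hmu := neg_abs_le mu
    have hdiv : P ^ θ / (2 * θ) + X ^ θ / (2 * θ) ≤ (P + X) ^ θ / (2 * θ) := by
      rw [← add_div]; gcongr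
    have hsplit : (1 / θ) * ((P + X) * 1) ^ θ = (P + X) ^ θ / (2 * θ) + (P + X) ^ θ / (2 * θ) := by
      rw [mul_one]; field_simp; ring
    rw [hsplit] at hmain
    have hg2 : g2 / 2 ≤ X ^ θ / (2 * θ) := hb
    rw [one_pow, mul_one] at hmain
    linarith
  -- conclusion
  have hγ : 0 < 1 + α / θ := by positivity
  refine ⟨|M1| + Q ^ (1 / θ) * 2 ^ (α / θ) + B, by positivity, fun y => ?_⟩
  have hyp : 0 ≤ ‖y‖ ^ (1 + α / θ) := by positivity
  have hM := le_abs_self M1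
  have hM0 := abs_nonneg M1
  have hq0 : 0 ≤ Q ^ (1 / θ) * 2 ^ (α / θ) := by positivity
  by_cases h : ‖y‖ ≤ 1
  · have := hM1 y h
    nlinarith
  · push Not at h
    have h1 := key y h.le
    have h2 : ‖y‖ ^ (-a) ≤ 1 := Real.rpow_le_one_of_one_le_of_nonpos h.le (by linarith)
    have h3 : (Q ^ (1 / θ) * (2 * ‖y‖) ^ (α / θ)) * ‖y‖
        = Q ^ (1 / θ) * 2 ^ (α / θ) * ‖y‖ ^ (1 + α / θ) := by
      rw [Real.mul_rpow (by norm_num) (norm_nonneg _), Real.rpow_add (by linarith), Real.rpow_one]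
      ring
    rw [h3] at h1
    have h4 : B * ‖y‖ ^ (-a) ≤ B := by nlinarith
    nlinarith

set_option maxHeartbeats 1000000 in
theorem super_growth (hθ : 1 < θ) {α f₀ lam mu : ℝ} (hα : 0 < α) (hf₀ : 0 < f₀)
    (hf : ∀ y, f₀⁻¹ * (‖y‖ ^ α + 1) ≤ f y) {φ ψ : EuclideanSpace ℝ (Fin m) → ℝ}
    (hsol : IsSolution θ f lam φ) (hsub : IsSubsolution θ f mu ψ) (hlt : lam < mu) :
    ∃ k : ℝ, 0 < k ∧ ∀ ρ : ℝ, 0 ≤ ρ → ρ < 1 → ∀ C : ℝ, (∀ y, -C ≤ φ y - ρ * ψ y) →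
      ∃ C' : ℝ, ∀ y, (1 - ρ) * k * ‖y‖ ^ (1 + α / θ) - C' ≤ φ y - ρ * ψ y := by
  have hθ0 : 0 < θ := by linarith
  set e : ℝ := f₀⁻¹ * (1 / 2) ^ α with he
  have he0 : 0 < e := by positivity
  obtain ⟨k, hk0, hk1, hk2⟩ : ∃ k : ℝ, 0 < k ∧ k ≤ 1 ∧ (m + 1) * k ≤ e / 2 := by
    refine ⟨min 1 (e / 2 / (m + 1)), lt_min one_pos (by positivity), min_le_left _ _, ?_⟩
    have := min_le_right 1 (e / 2 / (m + 1))
    calc _ ≤ ((m : ℝ) + 1) * (e / 2 / (m + 1)) := by gcongr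
      _ = e / 2 := by field_simp
  set R0 : ℝ := max 1 ((2 * |lam| / e + 1) ^ (1 / α)) with hR0
  refine ⟨k / 4, by positivity, fun ρ hρ0 hρ1 C hC => ?_⟩
  refine ⟨C + (1 - ρ) * (k / 4) * R0 ^ (1 + α / θ), fun y0 => ?_⟩
  have hρ2 : 0 < 1 - ρ := by linarith
  have hγ : 0 < 1 + α / θ := by positivity
  have hkk : 0 ≤ (1 - ρ) * (k / 4) := by positivity
  have hR0pos : 0 ≤ R0 := le_trans zero_le_one (le_max_left _ _)
  by_cases hsmall : ‖y0‖ < R0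
  · have h1 : ‖y0‖ ^ (1 + α / θ) ≤ R0 ^ (1 + α / θ) :=
      Real.rpow_le_rpow (norm_nonneg _) hsmall.le hγ.le
    have := mul_le_mul_of_nonneg_left h1 hkk
    have := hC y0
    linarith
  push Not at hsmall
  set R : ℝ := ‖y0‖ with hR
  have hR1 : 1 ≤ R := (le_max_left _ _).trans hsmall
  have hRp : 0 < R := by linarith
  have hRα : 2 * |lam| / e + 1 ≤ R ^ α := by
    have hb : 0 ≤ 2 * |lam| / e + 1 := by positivity
    have h1 : ((2 * |lam| / e + 1) ^ (1 / α)) ^ α ≤ R ^ α :=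
      Real.rpow_le_rpow (by positivity) ((le_max_right _ _).trans hsmall) hα.le
    rwa [← Real.rpow_mul hb, one_div, inv_mul_cancel₀ hα.ne', Real.rpow_one] at h1
  have hRα2 : |lam| < e / 2 * R ^ α := by
    have h1 := mul_le_mul_of_nonneg_left hRα (by positivity : 0 ≤ e / 2)
    have h2 : e / 2 * (2 * |lam| / e + 1) = |lam| + e / 2 := by field_simp
    linarith
  set K : ℝ := k * R ^ (α / θ - 1) with hK
  have hK0 : 0 < K := by positivity
  have hKR : K * R = k * R ^ (α / θ) := by
    rw [hK, mul_assoc, ← Real.rpow_add_one hRp.ne']; congr 2; ring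
  have hKR2 : K * (R / 2) ^ 2 = k / 4 * R ^ (1 + α / θ) := by
    have : R ^ (1 + α / θ) = R * R ^ (α / θ) := by rw [Real.rpow_add hRp, Real.rpow_one]
    rw [this]
    linear_combination R / 4 * hKR
  by_contra hcon
  push Not at hcon
  have hcon2 : φ y0 - ρ * ψ y0 < -C + (1 - ρ) * (k / 4) * R ^ (1 + α / θ) := by
    have : 0 ≤ (1 - ρ) * (k / 4) * R0 ^ (1 + α / θ) := by positivity
    linarith
  let w : EuclideanSpace ℝ (Fin m) → ℝ := fun y => φ y + (-1) *
    (ρ * ψ y + (1 - ρ) * ((-K) * ‖y - y0‖ ^ 2))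
  have hwc : Continuous w := by
    have h1 := hsol.1.continuous
    have h2 := hsub.1.continuous
    fun_prop
  have hy0 : y0 ∈ Metric.closedBall y0 (R / 2) := Metric.mem_closedBall_self (by positivity)
  obtain ⟨z, hzB, hz⟩ := (isCompact_closedBall y0 (R / 2)).exists_isMinOn ⟨y0, hy0⟩
    hwc.continuousOn
  have hzy : w z ≤ w y0 := hz hy0
  rw [Metric.mem_closedBall, dist_eq_norm] at hzB
  have hw0 : w y0 = φ y0 - ρ * ψ y0 := by simp [w]; ring
  have hzlt : ‖z - y0‖ < R / 2 := by
    refine lt_of_le_of_ne hzB fun h => ?_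
    have h1 : w z = φ z - ρ * ψ z + (1 - ρ) * (K * (R / 2) ^ 2) := by
      simp only [w, h]; ring
    have h2 := hC z
    rw [hKR2] at h1
    linarith
  have hloc : IsLocalMin w z := by
    refine hz.isLocalMin ?_
    refine mem_of_superset (Metric.isOpen_ball.mem_nhds ?_) Metric.ball_subset_closedBall
    rw [Metric.mem_ball, dist_eq_norm]; exact hzlt
  have hj1 := HasJet.of_contDiff hsub.1 z
  have hj2 := (HasJet.normSq z y0).smul (-K)
  have hmain := touch_sol hsol ((hj1.smul ρ).add (hj2.smul (1 - ρ))) hloc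
  have hcv := ham_convex hθ hρ0 hρ1.le (gradient ψ z) ((-K) • (2:ℝ) • (z - y0)) (lap ψ z)
    (-K * (2 * m))
  have hs := mul_le_mul_of_nonneg_left (hsub.2 z) hρ0
  have hn : ‖(-K) • (2:ℝ) • (z - y0)‖ ≤ K * R := by
    rw [norm_smul, norm_smul, norm_neg, Real.norm_of_nonneg hK0.le,
      Real.norm_of_nonneg (by norm_num)]
    apply mul_le_mul_of_nonneg_left _ hK0.le
    linarith
  have hRα0 : 0 < R ^ α := by positivity
  have hn2 : (1/θ) * ‖(-K) • (2:ℝ) • (z - y0)‖ ^ θ ≤ k * R ^ α := by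
    have h1 : ‖(-K) • (2:ℝ) • (z - y0)‖ ^ θ ≤ (K * R) ^ θ :=
      Real.rpow_le_rpow (norm_nonneg _) hn hθ0.le
    have h2 : (K * R) ^ θ = k ^ θ * R ^ α := by
      rw [hKR, Real.mul_rpow hk0.le (by positivity), ← Real.rpow_mul hRp.le]
      congr 2; field_simp
    have h3 : k ^ θ ≤ k := by
      calc k ^ θ ≤ k ^ (1:ℝ) := Real.rpow_le_rpow_of_exponent_ge hk0 hk1 hθ.le
        _ = k := Real.rpow_one k
    have h4 : 1 / θ ≤ 1 := by rw [div_le_one hθ0]; linarith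
    calc (1/θ) * ‖(-K) • (2:ℝ) • (z - y0)‖ ^ θ ≤ 1 * (K * R) ^ θ := by gcongr
      _ = k ^ θ * R ^ α := by rw [one_mul, h2]
      _ ≤ k * R ^ α := by gcongr
  have hKm : K ≤ k * R ^ α := by
    rw [hK]
    apply mul_le_mul_of_nonneg_left _ hk0.le
    apply Real.rpow_le_rpow_of_exponent_le hR1
    have : α / θ ≤ α := div_le_self hα.le hθ.le
    linarith
  have hH : -(1/2) * (-K * (2 * m)) + (1/θ) * ‖(-K) • (2:ℝ) • (z - y0)‖ ^ θ ≤ e / 2 * R ^ α := by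
    have h1 : (m : ℝ) * K ≤ m * (k * R ^ α) := by gcongr
    have h2 := mul_le_mul_of_nonneg_right hk2 hRα0.le
    have h3 : ((m : ℝ) + 1) * k * R ^ α = m * (k * R ^ α) + k * R ^ α := by ring
    have h4 : -(1/2) * (-K * (2 * (m : ℝ))) = m * K := by ring
    rw [h4]
    linarith
  have hH2 := mul_le_mul_of_nonneg_left hH hρ2.le
  have hfz : e * R ^ α ≤ f z := by
    have h1 : R / 2 ≤ ‖z‖ := by
      have := norm_sub_norm_le y0 z
      rw [norm_sub_rev] at this
      linarith
    have h2 : (R / 2) ^ α ≤ ‖z‖ ^ α := Real.rpow_le_rpow (by positivity) h1 hα.le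
    have h3 : (R / 2) ^ α = (1 / 2) ^ α * R ^ α := by
      rw [← Real.mul_rpow (by norm_num) hRp.le]; congr 1; ring
    refine le_trans ?_ (hf z)
    rw [he, mul_assoc, ← h3]
    apply mul_le_mul_of_nonneg_left _ (by positivity)
    linarith
  have hl := le_abs_self lam
  have h9 : (1 - ρ) * (f z - e / 2 * R ^ α) ≤ (1 - ρ) * lam := by
    have h8 : 0 ≤ ρ * (mu - lam) := mul_nonneg hρ0 (by linarith)
    linarith
  have h10 := le_of_mul_le_mul_left h9 hρ2
  linarith

theorem caseB (hθ : 1 < θ) (hθ2 : θ < 2) {α f₀ lam mu : ℝ} (hα : 0 < α) (hf₀ : 0 < f₀)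
    (hf : H1 f α f₀) {φ ψ : EuclideanSpace ℝ (Fin m) → ℝ} (hsol : IsSolution θ f lam φ)
    (hφ : BddBelow (Set.range φ)) (hsub : IsSubsolution θ f mu ψ) : mu ≤ lam := by
  by_contra hlt
  push Not at hlt
  have hθ0 : 0 < θ := by linarith
  have hγ : 0 < 1 + α / θ := by positivity
  obtain ⟨b, hb⟩ := hφ
  replace hb : ∀ y, b ≤ φ y := fun y => hb ⟨y, rfl⟩
  obtain ⟨C1, hC1, hψ⟩ := sub_growth hθ hθ2 hα hf₀ (fun y => (hf y).2) hsub
  obtain ⟨k, hk, hstep⟩ := super_growth hθ hα hf₀ (fun y => (hf y).1) hsol hsub hlt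
  obtain ⟨δ, hδ, hδ1, hδ2⟩ : ∃ δ : ℝ, 0 < δ ∧ δ < 1 ∧ δ * |mu| < mu - lam := by
    have h0 := abs_nonneg mu
    refine ⟨min (1/2) ((mu - lam) / (2 * (|mu| + 1))), ?_, ?_, ?_⟩
    · exact lt_min (by norm_num) (by apply div_pos <;> linarith)
    · exact (min_le_left _ _).trans_lt (by norm_num)
    · have h1 := min_le_right (1/2) ((mu - lam) / (2 * (|mu| + 1)))
      calc _ ≤ ((mu - lam) / (2 * (|mu| + 1))) * |mu| := mul_le_mul_of_nonneg_right h1 h0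
        _ < _ := by
          rw [div_mul_eq_mul_div, div_lt_iff₀ (by positivity)]
          nlinarith
  set h : ℝ := δ * k / C1 with hh
  have hh0 : 0 < h := by positivity
  have hind : ∀ n : ℕ, ∀ ρ : ℝ, 0 ≤ ρ → ρ ≤ 1 - δ → ρ ≤ n * h →
      ∃ C, ∀ y, -C ≤ φ y - ρ * ψ y := by
    intro n
    induction n with
    | zero =>
      intro ρ h0 _ h1
      have : ρ = 0 := le_antisymm (by simpa using h1) h0
      subst this
      exact ⟨-b, fun y => by simpa using hb y⟩
    | succ n ih =>
      intro ρ h0 h1 h2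
      push_cast at h2
      set ρ0 := max 0 (ρ - h) with hρ0
      have a1 : 0 ≤ ρ0 := le_max_left _ _
      have a2 : ρ0 ≤ ρ := max_le h0 (by linarith)
      have a3 : ρ - h ≤ ρ0 := le_max_right _ _
      have a4 : ρ0 ≤ n * h := max_le (by positivity) (by linarith)
      obtain ⟨C, hC⟩ := ih ρ0 a1 (by linarith) a4
      obtain ⟨C', hC'⟩ := hstep ρ0 a1 (by linarith) C hC
      refine ⟨C' + (ρ - ρ0) * C1, fun y => ?_⟩
      have b1 := hC' y
      have b2 := mul_le_mul_of_nonneg_left (hψ y) (by linarith : 0 ≤ ρ - ρ0)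
      have b3 : 0 ≤ ‖y‖ ^ (1 + α / θ) := by positivity
      have b4 : (ρ - ρ0) * C1 ≤ (1 - ρ0) * k := by
        have : (ρ - ρ0) * C1 ≤ h * C1 := by gcongr; linarith
        have e : h * C1 = δ * k := by rw [hh]; field_simp
        have : δ * k ≤ (1 - ρ0) * k := by gcongr; linarith
        linarith
      have b5 := mul_le_mul_of_nonneg_right b4 b3
      linarith
  obtain ⟨n, hn⟩ := exists_nat_ge (1 / h)
  have hn' : 1 - δ ≤ n * h := by
    rw [div_le_iff₀ hh0] at hn
    linarith
  obtain ⟨C, hC⟩ := hind n (1 - δ) (by linarith) le_rfl hn'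
  obtain ⟨C', hC'⟩ := hstep (1 - δ) (by linarith) (by linarith) C hC
  let w : EuclideanSpace ℝ (Fin m) → ℝ := fun y => φ y + (-1) * ((1 - δ) * ψ y)
  have hwc : Continuous w := by
    have h1 := hsol.1.continuous
    have h2 := hsub.1.continuous
    fun_prop
  have hwt : Tendsto w (cocompact _) atTop := by
    have h1 : Tendsto (fun y : EuclideanSpace ℝ (Fin m) => ‖y‖ ^ (1 + α / θ))
        (cocompact _) atTop :=
      (tendsto_rpow_atTop hγ).comp (tendsto_norm_cocompact_atTop)
    have h2 := tendsto_atTop_add_const_left _ (-C') (h1.const_mul_atTop (mul_pos hδ hk))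
    refine tendsto_atTop_mono (fun y => ?_) h2
    have := hC' y
    simp only [w]
    linarith
  obtain ⟨z, hz⟩ := hwc.exists_forall_le hwt
  have hmain := touch_sol hsol ((HasJet.of_contDiff hsub.1 z).smul (1 - δ))
    (Eventually.of_forall hz)
  have hcv := ham_convex hθ (by linarith : 0 ≤ 1 - δ) (by linarith) (gradient ψ z) 0 (lap ψ z) 0
  simp only [smul_zero, add_zero, norm_zero, Real.zero_rpow hθ0.ne', mul_zero] at hcv
  have hs := mul_le_mul_of_nonneg_left (hsub.2 z) (by linarith : 0 ≤ 1 - δ)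
  have hfz : 0 ≤ f z := le_trans (by positivity) (hf z).1
  have h1 : 0 ≤ δ * f z := by positivity
  have h2 : δ * mu ≤ δ * |mu| := by gcongr; exact le_abs_self mu
  linarith

end caseB

theorem stmt18 (m : ℕ) (hm : 1 ≤ m) (θ : ℝ) (hθ : 1 < θ)
    (f : EuclideanSpace ℝ (Fin m) → ℝ)
    (hcase : (2 ≤ θ ∧ LocallyLipschitz f ∧ Coercive f) ∨
      (θ < 2 ∧ ∃ α f₀ : ℝ, 0 < α ∧ 0 < f₀ ∧ H0 f α f₀ ∧ H1 f α f₀))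
    (lam : ℝ) (φ : EuclideanSpace ℝ (Fin m) → ℝ) (hsol : IsSolution θ f lam φ)
    (hφ : BddBelow (Set.range φ)) :
    lam = lambdaStar θ f := by
  have hmax : IsGreatest {lam : ℝ | ∃ φ, IsSubsolution θ f lam φ} lam := by
    refine ⟨⟨φ, hsol.1, fun y => (hsol.2 y).le⟩, ?_⟩
    rintro mu ⟨ψ, hψ⟩
    rcases hcase with ⟨h1, h2, h3⟩ | ⟨h1, α, f₀, h2, h3, _, h5⟩
    · exact caseA h1 h2 h3 hsol hφ hψ
    · exact caseB hθ h1 h2 h3 h5 hsol hφ hψ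
  exact hmax.csSup_eq.symm
end
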